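/- Let G be a minimal counterexample, with non-inner class-preserving Coleman automorphism φ of 2-power order. If M is a minimal normal subgroup of G that is a p-group for some odd prime p (equivalently, M is a minimal normal subgroup contained in the odd part O_{2'}(F(G)) of the Fitting subgroup), then M is cyclic (indeed of order p). -/

import Mathlib

/-- A finite 2-group of order `2^n` (`n ≥ 4`) is semidihedral if it is generated by
elements `a`, `b` with `a^(2^(n-1)) = 1`, `b^2 = 1` and `b⁻¹ * a * b = a^(2^(n-2) - 1)`. -/
def IsSemidihedral (S : Type*) [Group S] : Prop :=
  ∃ n : ℕ, 4 ≤ n ∧ Nat.card S = 2 ^ n ∧ ∃ a b : S,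
    a ^ (2 ^ (n - 1)) = 1 ∧ b ^ 2 = 1 ∧ b⁻¹ * a * b = a ^ (2 ^ (n - 2) - 1) ∧
    Subgroup.closure {a, b} = ⊤

/-- An automorphism is class-preserving if it maps every element to a conjugate of itself. -/
def IsClassPres {G : Type*} [Group G] (φ : MulAut G) : Prop :=
  ∀ g : G, IsConj g (φ g)

/-- An automorphism is Coleman if its restriction to every Sylow subgroup is given by
conjugation by some element of the group. -/
def IsColemanAut {G : Type*} [Group G] (φ : MulAut G) : Prop :=
  ∀ p : ℕ, p.Prime → ∀ P : Sylow p G, ∃ x : G, ∀ u ∈ (P : Subgroup G), φ u = x⁻¹ * u * x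

/-- An automorphism is inner if it is conjugation by some group element. -/
def IsInnerAut {G : Type*} [Group G] (φ : MulAut G) : Prop :=
  ∃ g : G, φ = MulAut.conj g

universe u

/-- `G`, with automorphism `φ`, is a minimal counterexample: `G` is a finite group with
semidihedral Sylow 2-subgroups, `φ` is a non-inner class-preserving Coleman automorphism
of `G` of 2-power order, and every finite group of smaller order with semidihedral Sylow
2-subgroups admits no non-inner class-preserving Coleman automorphism of 2-power order. -/
def IsMinimalCounterexample (G : Type u) [Group G] [Finite G] (φ : MulAut G) : Prop :=
  (∀ S : Sylow 2 G, IsSemidihedral (S : Subgroup G)) ∧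
  ¬ IsInnerAut φ ∧ (∃ k : ℕ, orderOf φ = 2 ^ k) ∧ IsClassPres φ ∧ IsColemanAut φ ∧
  ∀ (H : Type u) [Group H] [Finite H], Nat.card H < Nat.card G →
    (∀ S : Sylow 2 H, IsSemidihedral (S : Subgroup H)) →
    ∀ ψ : MulAut H, (∃ k : ℕ, orderOf ψ = 2 ^ k) → IsClassPres ψ → IsColemanAut ψ →
      IsInnerAut ψ

theorem exists_pow_modEq_one_two_power {G : Type*} [Group G] [Finite G] (g : G) (K : ℕ) :
    ∃ n j : ℕ, n ≡ 1 [MOD 2 ^ K] ∧ (g ^ n) ^ (2 ^ j) = 1 := by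
  obtain ⟨j, r, hr, h⟩ := Nat.exists_eq_two_pow_mul_odd (orderOf_pos g).ne'
  obtain ⟨n, hn1, hn2⟩ := Nat.chineseRemainder
    (Nat.Coprime.pow_left K (Nat.coprime_two_left.mpr hr)) 1 0
  refine ⟨n, j, hn1, ?_⟩
  obtain ⟨c, rfl⟩ := (Nat.modEq_zero_iff_dvd).1 hn2
  rw [← pow_mul, ← orderOf_dvd_iff_pow_eq_one, h]
  exact ⟨c, by ring⟩

/-- The first cohomology of a group with coefficients in a module of coprime order vanishes. -/
theorem exists_eq_conj_of_coprime {G : Type*} [Group G] [Finite G] (M Q : Subgroup G)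
    (hM : ∀ x ∈ M, ∀ y ∈ M, x * y = y * x) (hQ : ∀ u ∈ Q, ∀ m ∈ M, u * m * u⁻¹ ∈ M)
    (φ : G →* G) (hφ : ∀ u ∈ Q, φ u * u⁻¹ ∈ M) (hco : (Nat.card Q).Coprime (Nat.card M)) :
    ∃ m ∈ M, ∀ u ∈ Q, φ u = m * u * m⁻¹ := by
  classical
  have := Fintype.ofFinite Q
  let _ : CommGroup M :=
    { (inferInstance : Group M) with mul_comm := fun x y => Subtype.ext (hM x x.2 y y.2) }
  let c : Q → M := fun u => ⟨φ u * (u : G)⁻¹, hφ u u.2⟩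
  let act : Q → M →* M := fun u =>
    { toFun := fun m => ⟨u * m * (u : G)⁻¹, hQ u u.2 m m.2⟩
      map_one' := by ext; simp
      map_mul' := fun x y => by ext; simp [mul_assoc] }
  have hc : ∀ u v : Q, c (u * v) = c u * act u (c v) := by
    intro u v; ext; simp [c, act, mul_assoc]
  let d : M := ∏ v, c v
  have hd : ∀ u, d = c u ^ Nat.card Q * act u d := by
    intro u
    calc d = ∏ v, c (u * v) := (Equiv.prod_comp (Equiv.mulLeft u) c).symm
      _ = c u ^ Nat.card Q * act u d := by
        simp only [hc, Finset.prod_mul_distrib, d, map_prod]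
        simp [Nat.card_eq_fintype_card]
  obtain ⟨n, hn0, he⟩ := Nat.chineseRemainder hco 0 1
  obtain ⟨e, rfl⟩ := (Nat.modEq_zero_iff_dvd).1 hn0
  have hpow : ∀ m : M, (m ^ Nat.card Q) ^ e = m := by
    intro m
    rw [← pow_mul]
    conv_rhs => rw [← pow_one m]
    rw [pow_eq_pow_iff_modEq]
    exact he.of_dvd (orderOf_dvd_natCard m)
  refine ⟨((d ^ e : M) : G), (d ^ e).2, fun u hu => ?_⟩
  have h := congrArg (· ^ e) (hd ⟨u, hu⟩)
  simp only [mul_pow, hpow, ← map_pow] at h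
  have h2 := congrArg (Subtype.val) h
  simp only [c, act, Subgroup.coe_mul, MonoidHom.coe_mk, OneHom.coe_mk] at h2
  have h3 : ((d ^ e : M) : G) * u = φ u * ((d ^ e : M) : G) := by
    conv_lhs => rw [h2]
    group
  rw [h3]; group

theorem eq_top_of_forall_exists_conj_mem {K : Type*} [Group K] [Finite K] (L : Subgroup K)
    (h : ∀ k : K, ∃ g : K, g⁻¹ * k * g ∈ L) : L = ⊤ := by
  classical
  have := Fintype.ofFinite K
  have := Fintype.ofFinite (K ⧸ L)
  have hb := MulAction.sum_card_fixedBy_eq_card_orbits_mul_card_group K (K ⧸ L)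
  have hone : Fintype.card (Quotient (MulAction.orbitRel K (K ⧸ L))) = 1 := by
    rw [Fintype.card_eq_one_iff_nonempty_unique]
    have : Subsingleton (MulAction.orbitRel.Quotient K (K ⧸ L)) :=
      (MulAction.pretransitive_iff_subsingleton_quotient K (K ⧸ L)).1 inferInstance
    exact ⟨@Unique.mk' _ ⟨Quotient.mk _ ((1 : K) : K ⧸ L)⟩ this⟩
  rw [hone, one_mul] at hb
  have hge : ∀ k : K, 1 ≤ Fintype.card (MulAction.fixedBy (K ⧸ L) k) := by
    intro k
    obtain ⟨g, hg⟩ := h k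
    rw [Nat.one_le_iff_ne_zero, ← Nat.pos_iff_ne_zero, Fintype.card_pos_iff]
    refine ⟨⟨(g : K ⧸ L), ?_⟩⟩
    rw [MulAction.mem_fixedBy]
    change ((k * g : K) : K ⧸ L) = g
    refine (QuotientGroup.eq.2 ?_).symm
    simpa [mul_assoc] using hg
  have heq : ∀ k ∈ (Finset.univ : Finset K), (1 : ℕ) = Fintype.card (MulAction.fixedBy (K ⧸ L) k) := by
    rw [← Finset.sum_eq_sum_iff_of_le (fun k _ => hge k), hb]
    simp
  have h1 := heq 1 (Finset.mem_univ _)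
  rw [← Subgroup.index_eq_one, Subgroup.index_eq_card, Nat.card_eq_fintype_card, h1]
  exact Fintype.card_congr ((Equiv.Set.univ _).symm.trans (Equiv.setCongr (by ext; simp)))

theorem exists_conj_mem_sylow {G : Type*} [Group G] [Finite G] (P : Sylow 2 G) (t v : G)
    (htv : t * v = v * t) {i j : ℕ} (ht : t ^ (2 ^ i) = 1) (hv : v ^ (2 ^ j) = 1) :
    ∃ g : G, g * t * g⁻¹ ∈ P ∧ g * v * g⁻¹ ∈ P := by
  have hz : ∀ (x : G) (k : ℕ), x ^ (2 ^ k) = 1 → IsPGroup 2 (Subgroup.zpowers x) := by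
    intro x k hx
    obtain ⟨m, -, hm⟩ := (Nat.dvd_prime_pow Nat.prime_two).1 (orderOf_dvd_of_pow_eq_one hx)
    exact IsPGroup.of_card (n := m) (by rw [Nat.card_zpowers, hm])
  have hle : Subgroup.zpowers t ≤ Subgroup.normalizer (Subgroup.zpowers v : Set G) := by
    refine le_trans ?_ (Subgroup.centralizer_le_normalizer _)
    rw [Subgroup.zpowers_le, Subgroup.mem_centralizer_iff]
    rintro _ ⟨n, rfl⟩
    exact ((show Commute t v from htv).zpow_right n).eq.symm
  obtain ⟨Q, hQ⟩ := ((hz t i ht).to_sup_of_normal_right' (hz v j hv) hle).exists_le_sylow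
  obtain ⟨g, hg⟩ := MulAction.exists_smul_eq G Q P
  have hmem : ∀ x ∈ Q, g * x * g⁻¹ ∈ P := by
    intro x hx
    rw [← hg, ← MulAut.conj_apply]
    exact Subgroup.smul_mem_pointwise_smul _ (MulAut.conj g) _ hx
  exact ⟨g, hmem _ (hQ (Subgroup.mem_sup_left (Subgroup.mem_zpowers t))),
    hmem _ (hQ (Subgroup.mem_sup_right (Subgroup.mem_zpowers v)))⟩

theorem exists_conj_mem_map_sylow {G A : Type*} [Group G] [Finite G] [Group A] (ρ : G →* A)
    (P : Sylow 2 G) (c d : G)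
    (hcd : ρ c * ρ d = ρ d * ρ c) {i j : ℕ} (hc : ρ c ^ (2 ^ i) = 1) (hd : ρ d ^ (2 ^ j) = 1) :
    ∃ g : G, (∃ s ∈ P, ρ (g * c * g⁻¹) = ρ s) ∧ ∃ s ∈ P, ρ (g * d * g⁻¹) = ρ s := by
  have : Finite ρ.range := Finite.of_surjective _ ρ.rangeRestrict_surjective
  obtain ⟨⟨_, g, rfl⟩, h1, h2⟩ := exists_conj_mem_sylow
    (P.mapSurjective ρ.rangeRestrict_surjective) (ρ.rangeRestrict c) (ρ.rangeRestrict d)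
    (Subtype.ext hcd) (i := i) (j := j) (Subtype.ext hc) (Subtype.ext hd)
  obtain ⟨s, hs, hs'⟩ := h1
  obtain ⟨s2, hs2, hs2'⟩ := h2
  have e1 := congrArg Subtype.val hs'
  have e2 := congrArg Subtype.val hs2'
  exact ⟨g, ⟨s, hs, by simpa using e1.symm⟩, ⟨s2, hs2, by simpa using e2.symm⟩⟩

theorem sq_eq_one_of_pow_two_pow_sub_two {A : Type*} [Group A] {y : A} {j k : ℕ} (hk : 2 ≤ k)
    (h1 : y ^ 2 ^ j = 1) (h2 : y ^ (2 ^ k - 2) = 1) : y ^ 2 = 1 := by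
  obtain ⟨l, rfl⟩ := Nat.exists_eq_add_of_le hk
  have hodd : Odd (2 ^ (l + 1) - 1) := by
    refine Nat.Even.sub_odd Nat.one_le_two_pow ?_ odd_one
    exact (Nat.even_pow.2 ⟨even_two, by omega⟩)
  have he : 2 ^ (2 + l) - 2 = 2 * (2 ^ (l + 1) - 1) := by
    rw [Nat.mul_sub]; congr 1; ring
  rw [← orderOf_dvd_iff_pow_eq_one] at *
  rw [he] at h2
  have hco : (orderOf y).Coprime (2 ^ (l + 1) - 1) :=
    Nat.Coprime.coprime_dvd_left h1 (Nat.Coprime.pow_left j (Nat.coprime_two_left.mpr hodd))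
  exact hco.dvd_of_dvd_mul_right h2

theorem eq_of_mem_zpowers_of_sq_eq_one {A : Type*} [Group A] {α u v : A} (hα : IsOfFinOrder α)
    (hu : u ∈ Subgroup.zpowers α) (hv : v ∈ Subgroup.zpowers α) (hu1 : u ≠ 1) (hv1 : v ≠ 1)
    (hu2 : u ^ 2 = 1) (hv2 : v ^ 2 = 1) : u = v := by
  classical
  have : Finite (Subgroup.zpowers α) := hα.finite_zpowers
  have := Fintype.ofFinite (Subgroup.zpowers α)
  by_contra hne
  have hle := IsCyclic.card_pow_eq_one_le (α := Subgroup.zpowers α) (n := 2) two_pos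
  have hsub : ({1, ⟨u, hu⟩, ⟨v, hv⟩} : Finset (Subgroup.zpowers α)) ⊆
      Finset.univ.filter fun x => x ^ 2 = 1 := by
    intro x hx
    simp only [Finset.mem_insert, Finset.mem_singleton] at hx
    rcases hx with rfl | rfl | rfl
    · simp
    · simpa [Subtype.ext_iff] using hu2
    · simpa [Subtype.ext_iff] using hv2
  have h3 := (Finset.card_le_card hsub).trans hle
  rw [Finset.card_insert_of_notMem, Finset.card_pair] at h3
  · omega
  · simpa [Subtype.ext_iff] using hne
  · simp only [Finset.mem_insert, Finset.mem_singleton, Subtype.ext_iff, not_or]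
    exact ⟨hu1.symm, hv1.symm⟩

theorem mem_zpowers_of_sq_eq_one {A : Type*} [Group A] {α u v : A} {N : ℕ} (hα : α ^ 2 ^ N = 1)
    (hu : u ∈ Subgroup.zpowers α) (hv : v ∈ Subgroup.zpowers α) (hu1 : u ≠ 1)
    (hv2 : v ^ 2 = 1) : v ∈ Subgroup.zpowers u := by
  by_cases hv1 : v = 1
  · rw [hv1]; exact one_mem _
  have hfin : IsOfFinOrder α := isOfFinOrder_iff_pow_eq_one.2 ⟨2 ^ N, by positivity, hα⟩
  have huN : u ^ 2 ^ N = 1 := by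
    obtain ⟨i, rfl⟩ := hu
    change (α ^ i) ^ 2 ^ N = 1
    rw [← zpow_natCast, ← zpow_mul, mul_comm, zpow_mul, zpow_natCast, hα, one_zpow]
  obtain ⟨i, -, hi⟩ := (Nat.dvd_prime_pow Nat.prime_two).1 (orderOf_dvd_of_pow_eq_one huN)
  obtain ⟨i, rfl⟩ : ∃ l, i = l + 1 := by
    refine Nat.exists_eq_succ_of_ne_zero ?_
    rintro rfl
    exact hu1 (orderOf_eq_one_iff.1 (by simpa using hi))
  have h1 : u ^ 2 ^ i ≠ 1 := by
    intro h
    have := Nat.le_of_dvd (by positivity) (hi ▸ orderOf_dvd_of_pow_eq_one h)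
    rw [pow_succ] at this
    have := Nat.two_pow_pos i
    omega
  have h2 : (u ^ 2 ^ i) ^ 2 = 1 := by
    rw [← pow_mul, ← pow_succ, ← hi, pow_orderOf_eq_one]
  rw [← eq_of_mem_zpowers_of_sq_eq_one hfin (pow_mem hu _) hv h1 hv1 h2 hv2]
  exact Subgroup.npow_mem_zpowers _ _

/-- The elements `a`, of order `2 ^ (k + 1)`, and `b` are the standard generators of a
semidihedral group of order `2 ^ (k + 2)`. -/
structure IsSemidihedralPair {S : Type*} [Group S] (k : ℕ) (a b : S) : Prop where
  two_le : 2 ≤ k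
  orderOf_left : orderOf a = 2 ^ (k + 1)
  sq_right : b ^ 2 = 1
  conj_left : b⁻¹ * a * b = a ^ (2 ^ k - 1)
  right_notMem : b ∉ Subgroup.zpowers a
  mem_or_mul_mem : ∀ s, s ∈ Subgroup.zpowers a ∨ s * b ∈ Subgroup.zpowers a

theorem IsSemidihedral.exists_pair {S : Type*} [Group S] (h : IsSemidihedral S) :
    ∃ (k : ℕ) (a b : S), IsSemidihedralPair k a b := by
  obtain ⟨n, hn, hcard, a, b, ha, hb, hab, htop⟩ := h
  obtain ⟨k, rfl⟩ := Nat.exists_eq_add_of_le (show 2 ≤ n by omega)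
  have e1 : 2 + k - 2 = k := by omega
  have e2 : 2 + k - 1 = k + 1 := by omega
  rw [e1] at hab
  rw [e2] at ha
  have hb' : b⁻¹ = b := by rw [inv_eq_iff_mul_eq_one, ← pow_two, hb]
  have hbb : b * b = 1 := by rw [← pow_two, hb]
  have hconj : ∀ w ∈ Subgroup.zpowers a, b * w * b ∈ Subgroup.zpowers a := by
    rintro _ ⟨i, rfl⟩
    change b * a ^ i * b ∈ _
    have : b * a ^ i * b = (b⁻¹ * a * b⁻¹⁻¹) ^ i := by rw [conj_zpow, hb', hb']
    rw [this, inv_inv, hab]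
    exact zpow_mem (Subgroup.npow_mem_zpowers _ _) _
  have hmem : ∀ s, s ∈ Subgroup.zpowers a ∨ s * b ∈ Subgroup.zpowers a := by
    intro s
    have hs : s ∈ Subgroup.closure {a, b} := htop ▸ Subgroup.mem_top s
    induction hs using Subgroup.closure_induction with
    | mem x hx =>
      rcases hx with rfl | hx
      · exact Or.inl (Subgroup.mem_zpowers x)
      · rw [Set.mem_singleton_iff.1 hx, hbb]
        exact Or.inr (one_mem _)
    | one => exact Or.inl (one_mem _)
    | mul x y _ _ hx hy =>
      rcases hx with hx | hx <;> rcases hy with hy | hy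
      · exact Or.inl (mul_mem hx hy)
      · right; rw [mul_assoc]; exact mul_mem hx hy
      · right
        have : x * y * b = (x * b) * (b * y * b) := by
          simp only [mul_assoc]; rw [← mul_assoc b b, hbb, one_mul]
        rw [this]; exact mul_mem hx (hconj y hy)
      · left
        have : x * y = (x * b) * (b * (y * b) * b) := by
          simp only [mul_assoc]; rw [hbb, ← mul_assoc b b, hbb]; simp
        rw [this]; exact mul_mem hx (hconj _ hy)
    | inv x _ hx =>
      rcases hx with hx | hx
      · exact Or.inl (inv_mem hx)
      · right
        have : x⁻¹ * b = b * (x * b)⁻¹ * b := by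
          rw [mul_inv_rev, hb', ← mul_assoc, hbb, one_mul]
        rw [this]; exact hconj _ (inv_mem hx)
  have hfin : Finite S := Nat.finite_of_card_ne_zero (by rw [hcard]; positivity)
  have hodvd := orderOf_dvd_of_pow_eq_one ha
  have hole := Nat.le_of_dvd (by positivity) hodvd
  have hpos : 0 < 2 ^ (k + 1) := by positivity
  have hc2 : 2 ^ (2 + k) = 2 * 2 ^ (k + 1) := by ring
  have hzc : Nat.card (Subgroup.zpowers a) = orderOf a := Nat.card_zpowers a
  have hnot : b ∉ Subgroup.zpowers a := by
    intro hb1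
    have : Subgroup.zpowers a = ⊤ := by
      rw [eq_top_iff, ← htop, Subgroup.closure_le]
      rintro x (rfl | hx)
      · exact Subgroup.mem_zpowers x
      · rw [Set.mem_singleton_iff.1 hx]; exact hb1
    rw [this, Subgroup.card_top, hcard] at hzc
    omega
  have hord : orderOf a = 2 ^ (k + 1) := by
    refine le_antisymm hole ?_
    let F : Subgroup.zpowers a × Bool → S := fun p => if p.2 then p.1 * b else p.1
    have hF : Function.Surjective F := by
      intro s
      rcases hmem s with hs | hs
      · exact ⟨(⟨s, hs⟩, false), rfl⟩
      · exact ⟨(⟨s * b, hs⟩, true), by simp [F, mul_assoc, hbb]⟩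
    have := Nat.card_le_card_of_surjective F hF
    rw [Nat.card_prod, hzc, hcard] at this
    simp at this
    omega
  exact ⟨k, a, b, by omega, hord, hb, hab, hnot, hmem⟩

namespace IsSemidihedralPair

variable {S A : Type*} [Group S] [Group A] {k : ℕ} {a b : S}

theorem right_mul_right (h : IsSemidihedralPair k a b) : b * b = 1 := by
  rw [← pow_two, h.sq_right]

theorem inv_right (h : IsSemidihedralPair k a b) : b⁻¹ = b :=
  inv_eq_of_mul_eq_one_left h.right_mul_right

theorem pow_eq_one (h : IsSemidihedralPair k a b) {w : S} (hw : w ∈ Subgroup.zpowers a) :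
    w ^ 2 ^ (k + 1) = 1 := by
  obtain ⟨i, rfl⟩ := hw
  change (a ^ i) ^ 2 ^ (k + 1) = 1
  rw [← zpow_natCast, ← zpow_mul, mul_comm, zpow_mul, zpow_natCast, ← h.orderOf_left,
    pow_orderOf_eq_one, one_zpow]

theorem conj_eq (h : IsSemidihedralPair k a b) {s w : S} (hs : s ∉ Subgroup.zpowers a)
    (hw : w ∈ Subgroup.zpowers a) : s * w * s⁻¹ = w ^ (2 ^ k - 1) := by
  have hsb := (h.mem_or_mul_mem s).resolve_left hs
  obtain ⟨i, rfl⟩ := hw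
  change s * a ^ i * s⁻¹ = (a ^ i) ^ (2 ^ k - 1)
  have h1 : b * a * b⁻¹ = a ^ (2 ^ k - 1) := by
    have := h.conj_left
    rwa [h.inv_right] at this ⊢
  have h2 : b * a ^ i * b⁻¹ = (a ^ i) ^ (2 ^ k - 1) := by
    rw [← conj_zpow, h1, ← zpow_natCast, ← zpow_natCast, zpow_comm]
  obtain ⟨j, hj⟩ := hsb
  change a ^ j = s * b at hj
  have h3 : s = a ^ j * b := by rw [hj, mul_assoc, h.right_mul_right, mul_one]
  calc s * a ^ i * s⁻¹ = a ^ j * (b * a ^ i * b⁻¹) * (a ^ j)⁻¹ := by rw [h3]; group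
    _ = (a ^ i) ^ (2 ^ k - 1) := by
      rw [h2, ← zpow_natCast, ← zpow_mul, ← zpow_add, ← zpow_neg, ← zpow_add]
      congr 1; ring

theorem mul_mem_zpowers (h : IsSemidihedralPair k a b) {s t : S} (hs : s ∉ Subgroup.zpowers a)
    (ht : t ∉ Subgroup.zpowers a) : s * t ∈ Subgroup.zpowers a := by
  have hsb := (h.mem_or_mul_mem s).resolve_left hs
  have htb := (h.mem_or_mul_mem t).resolve_left ht
  have e : s * t = (s * b) * (b * (t * b) * b⁻¹) := by
    rw [h.inv_right]
    simp only [mul_assoc]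
    rw [h.right_mul_right, ← mul_assoc b b, h.right_mul_right]
    simp
  rw [e, h.conj_eq h.right_notMem htb]
  exact mul_mem hsb (pow_mem htb _)

theorem sq_mem_zpowers (h : IsSemidihedralPair k a b) (s : S) : s ^ 2 ∈ Subgroup.zpowers a := by
  by_cases hs : s ∈ Subgroup.zpowers a
  · exact pow_mem hs 2
  · rw [pow_two]; exact h.mul_mem_zpowers hs hs

theorem inv_notMem {s : S} (hs : s ∉ Subgroup.zpowers a) : s⁻¹ ∉ Subgroup.zpowers a :=
  fun h => hs (inv_mem_iff.1 h)

theorem sq_left_ne_one (h : IsSemidihedralPair k a b) : a ^ 2 ≠ 1 := by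
  intro h2
  have := Nat.le_of_dvd two_pos (h.orderOf_left ▸ orderOf_dvd_of_pow_eq_one h2)
  have h3 : 2 ^ 2 ≤ 2 ^ (k + 1) := Nat.pow_le_pow_right two_pos (by have := h.two_le; omega)
  omega

/-- `a ^ 2 ^ k` is the central involution of a semidihedral group. -/
theorem center_ne_one (h : IsSemidihedralPair k a b) : a ^ 2 ^ k ≠ 1 := by
  intro h2
  have := Nat.le_of_dvd (by positivity) (h.orderOf_left ▸ orderOf_dvd_of_pow_eq_one h2)
  exact absurd this (not_le.2 (Nat.pow_lt_pow_right one_lt_two (by omega)))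

theorem center_sq (h : IsSemidihedralPair k a b) : (a ^ 2 ^ k) ^ 2 = 1 := by
  rw [← pow_mul, ← pow_succ, ← h.orderOf_left, pow_orderOf_eq_one]

theorem isOfFinOrder_left (h : IsSemidihedralPair k a b) : IsOfFinOrder a :=
  isOfFinOrder_iff_pow_eq_one.2 ⟨2 ^ (k + 1), by positivity, h.pow_eq_one (Subgroup.mem_zpowers a)⟩

theorem eq_one_or_eq_center (h : IsSemidihedralPair k a b) {w : S}
    (hw : w ∈ Subgroup.zpowers a) (hw2 : w ^ 2 = 1) : w = 1 ∨ w = a ^ 2 ^ k :=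
  or_iff_not_imp_left.2 fun hw1 => eq_of_mem_zpowers_of_sq_eq_one h.isOfFinOrder_left hw
    (Subgroup.npow_mem_zpowers _ _) hw1 h.center_ne_one hw2 h.center_sq

theorem map_pow_eq_one (h : IsSemidihedralPair k a b) (f : S →* A) {w : S}
    (hw : w ∈ Subgroup.zpowers a) : f w ^ 2 ^ (k + 1) = 1 := by
  rw [← map_pow, h.pow_eq_one hw, map_one]

theorem map_sq_eq_one_of_commute (h : IsSemidihedralPair k a b) (f : S →* A) {s w : S}
    (hs : s ∉ Subgroup.zpowers a) (hw : w ∈ Subgroup.zpowers a) (hc : f s * f w = f w * f s) :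
    f w ^ 2 = 1 := by
  refine sq_eq_one_of_pow_two_pow_sub_two h.two_le (h.map_pow_eq_one f hw) ?_
  have h1 := congrArg f (h.conj_eq hs hw)
  rw [map_mul, map_mul, map_inv, hc, mul_inv_cancel_right, map_pow] at h1
  have h2 : 2 ^ k - 1 = (2 ^ k - 2) + 1 := by
    have : 2 ^ 1 ≤ 2 ^ k := Nat.pow_le_pow_right two_pos (by have := h.two_le; omega)
    omega
  rw [h2, pow_succ] at h1
  exact (right_eq_mul.1 h1)

theorem map_sq_eq_one_of_central (h : IsSemidihedralPair k a b) (f : S →* A) {x : S}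
    (hx : ∀ s, f x * f s = f s * f x) : f x ^ 2 = 1 := by
  by_cases hxa : x ∈ Subgroup.zpowers a
  · exact h.map_sq_eq_one_of_commute f h.right_notMem hxa (hx b).symm
  · have hxb := (h.mem_or_mul_mem x).resolve_left hxa
    have h1 := h.map_sq_eq_one_of_commute f hxa hxb (hx _)
    rw [map_mul, pow_two, mul_assoc, ← mul_assoc (f b), ← hx b, mul_assoc, ← map_mul f b b,
      h.right_mul_right, map_one, mul_one, ← pow_two] at h1
    exact h1

theorem map_sq_eq_one_of_notMem (h : IsSemidihedralPair k a b) (f : S →* A) {x : S}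
    (hx : ∀ s, f x * f s = f s * f x) (hxa : x ∉ Subgroup.zpowers a) (s : S) : f s ^ 2 = 1 := by
  by_cases hs : s ∈ Subgroup.zpowers a
  · exact h.map_sq_eq_one_of_commute f hxa hs (hx s)
  · have h1 := h.map_sq_eq_one_of_commute f hxa (h.mul_mem_zpowers hs hxa) (hx _)
    have hc : Commute (f s) (f x) := (hx s).symm
    rwa [map_mul, hc.mul_pow, h.map_sq_eq_one_of_central f hx, mul_one] at h1

theorem eq_one_or_eq_center_of_commute (h : IsSemidihedralPair k a b) {s w : S}
    (hs : s ∉ Subgroup.zpowers a) (hw : w ∈ Subgroup.zpowers a) (hc : s * w = w * s) :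
    w = 1 ∨ w = a ^ 2 ^ k :=
  h.eq_one_or_eq_center hw (h.map_sq_eq_one_of_commute (MonoidHom.id S) hs hw hc)

theorem map_eq_one_or_eq_of_commute (h : IsSemidihedralPair k a b) (f : S →* A)
    (hz : f (a ^ 2 ^ k) = 1) {s t : S} (hst : s * t = t * s) (hs2 : s ^ 2 = 1)
    (hs : f s ≠ 1) : f t = 1 ∨ f t = f s := by
  have key : ∀ w, w = 1 ∨ w = a ^ 2 ^ k → f w = 1 := by
    rintro w (rfl | rfl)
    · exact map_one f
    · exact hz
  have hsa : s ∉ Subgroup.zpowers a := fun hsa => hs (key s (h.eq_one_or_eq_center hsa hs2))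
  by_cases hta : t ∈ Subgroup.zpowers a
  · exact Or.inl (key t (h.eq_one_or_eq_center_of_commute hsa hta hst))
  · right
    have h1 := key _ (h.eq_one_or_eq_center_of_commute hsa
      (h.mul_mem_zpowers hta (inv_notMem hsa)) (by
        rw [← mul_assoc, hst]; group))
    rw [map_mul, map_inv] at h1
    exact mul_inv_eq_one.1 h1

theorem map_center_eq_one_of_map_eq_one (h : IsSemidihedralPair k a b) (f : S →* A) {s : S}
    (hs1 : s ≠ 1) (hs : f s = 1) : f (a ^ 2 ^ k) = 1 := by
  have key : ∀ w ∈ Subgroup.zpowers a, w ≠ 1 → f w = 1 → f (a ^ 2 ^ k) = 1 := by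
    intro w hw hw1 hfw
    obtain ⟨i, hi⟩ := mem_zpowers_of_sq_eq_one (h.pow_eq_one (Subgroup.mem_zpowers a)) hw
      (Subgroup.npow_mem_zpowers a (2 ^ k)) hw1 h.center_sq
    change w ^ i = _ at hi
    rw [← hi, map_zpow, hfw, one_zpow]
  by_cases hsa : s ∈ Subgroup.zpowers a
  · exact key s hsa hs1 hs
  · have ha := Subgroup.mem_zpowers a
    refine key (s * a * s⁻¹ * a⁻¹) ?_ ?_ (by simp [hs])
    · rw [h.conj_eq hsa ha]
      exact mul_mem (pow_mem ha _) (inv_mem ha)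
    · intro h1
      refine h.sq_left_ne_one (h.map_sq_eq_one_of_commute (MonoidHom.id S) hsa ha ?_)
      rw [mul_inv_eq_one, mul_inv_eq_iff_eq_mul] at h1
      exact h1

theorem eq_center_of_central (h : IsSemidihedralPair k a b) {x : S}
    (hx : ∀ s, x * s = s * x) (hx1 : x ≠ 1) : x = a ^ 2 ^ k := by
  by_cases hxa : x ∈ Subgroup.zpowers a
  · exact (h.eq_one_or_eq_center_of_commute h.right_notMem hxa (hx b).symm).resolve_left hx1
  · exact absurd (h.map_sq_eq_one_of_commute (MonoidHom.id S) hxa (Subgroup.mem_zpowers a) (hx a))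
      h.sq_left_ne_one

theorem central_mem_zpowers_of_sq_ne_one (h : IsSemidihedralPair k a b) (f : S →* A) {x s : S}
    (hx : ∀ s, f x * f s = f s * f x) (hs : f s ^ 2 ≠ 1) : f x ∈ Subgroup.zpowers (f s) := by
  by_cases hxa : x ∈ Subgroup.zpowers a
  · have h1 : ∀ w ∈ Subgroup.zpowers a, f w ∈ Subgroup.zpowers (f a) := by
      rintro _ ⟨i, rfl⟩; exact ⟨i, (map_zpow f a i).symm⟩
    have h2 := mem_zpowers_of_sq_eq_one (h.map_pow_eq_one f (Subgroup.mem_zpowers a))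
      (h1 _ (h.sq_mem_zpowers s)) (h1 x hxa) (by rwa [map_pow])
      (h.map_sq_eq_one_of_central f hx)
    rw [map_pow] at h2
    exact (Subgroup.zpowers_le.2 (Subgroup.npow_mem_zpowers (f s) 2)) h2
  · exact absurd (h.map_sq_eq_one_of_notMem f hx hxa s) hs

/-- A quotient of a semidihedral group contains no elementary abelian group of order `8` that
meets the center nontrivially. -/
theorem central_eq_of_commute (h : IsSemidihedralPair k a b) (f : S →* A) {x s t : S}
    (hx : ∀ s, f x * f s = f s * f x) (hx1 : f x ≠ 1) (hst : f s * f t = f t * f s)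
    (hs2 : f s ^ 2 = 1) (ht2 : f t ^ 2 = 1) (hs : f s ≠ 1) (ht : f t ≠ 1) (hne : f s ≠ f t) :
    f x = f s ∨ f x = f t ∨ f x = f s * f t := by
  have hfin : IsOfFinOrder (f a) := isOfFinOrder_iff_pow_eq_one.2
    ⟨2 ^ (k + 1), by positivity, h.map_pow_eq_one f (Subgroup.mem_zpowers a)⟩
  have hmap : ∀ w ∈ Subgroup.zpowers a, f w ∈ Subgroup.zpowers (f a) := by
    rintro _ ⟨i, rfl⟩; exact ⟨i, (map_zpow f a i).symm⟩
  have huniq : ∀ v ∈ Subgroup.zpowers a, ∀ w ∈ Subgroup.zpowers a, f v ≠ 1 → f w ≠ 1 →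
      f v ^ 2 = 1 → f w ^ 2 = 1 → f v = f w := fun v hv w hw h1 h2 h3 h4 =>
    eq_of_mem_zpowers_of_sq_eq_one hfin (hmap v hv) (hmap w hw) h1 h2 h3 h4
  have hx2 := h.map_sq_eq_one_of_central f hx
  have hinv : ∀ {y : A}, y ^ 2 = 1 → y⁻¹ = y := fun hy =>
    inv_eq_of_mul_eq_one_left (by rw [← pow_two, hy])
  have hprod : f s * f t ≠ 1 := fun h1 => hne (by rw [eq_inv_of_mul_eq_one_left h1, hinv ht2])
  have hprod2 : (f s * f t) ^ 2 = 1 := by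
    rw [(show Commute (f s) (f t) from hst).mul_pow, hs2, ht2, one_mul]
  by_cases hxa : x ∈ Subgroup.zpowers a
  · by_cases hsa : s ∈ Subgroup.zpowers a
    · exact Or.inl (huniq x hxa s hsa hx1 hs hx2 hs2)
    by_cases hta : t ∈ Subgroup.zpowers a
    · exact Or.inr (Or.inl (huniq x hxa t hta hx1 ht hx2 ht2))
    · rw [← map_mul] at hprod hprod2 ⊢
      exact Or.inr (Or.inr (huniq x hxa _ (h.mul_mem_zpowers hsa hta) hx1 hprod hx2 hprod2))
  · have hsq := h.map_sq_eq_one_of_notMem f hx hxa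
    have hxx : f x * f x = 1 := by rw [← pow_two, hx2]
    have hout : ∀ r, r ∉ Subgroup.zpowers a → f (r * x) ≠ 1 ∨ f x = f r := by
      intro r _
      refine or_iff_not_imp_left.2 fun h1 => ?_
      rw [not_not, map_mul] at h1
      rw [eq_inv_of_mul_eq_one_left h1, hinv hx2]
    by_cases hsa : s ∈ Subgroup.zpowers a <;> by_cases hta : t ∈ Subgroup.zpowers a
    · exact absurd (huniq s hsa t hta hs ht hs2 ht2) hne
    · rcases hout t hta with h1 | h1
      · have h2 := huniq s hsa _ (h.mul_mem_zpowers hta hxa) hs h1 hs2 (hsq _)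
        right; right
        rw [hst, h2, map_mul, ← mul_assoc, ← pow_two, ht2, one_mul]
      · exact Or.inr (Or.inl h1)
    · rcases hout s hsa with h1 | h1
      · have h2 := huniq t hta _ (h.mul_mem_zpowers hsa hxa) ht h1 ht2 (hsq _)
        right; right
        rw [h2, map_mul, ← mul_assoc, ← pow_two, hs2, one_mul]
      · exact Or.inl h1
    · rcases hout s hsa with h1 | h1
      · rcases hout t hta with h2 | h2
        · have h3 := huniq _ (h.mul_mem_zpowers hsa hxa) _ (h.mul_mem_zpowers hta hxa) h1 h2
            (hsq _) (hsq _)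
          rw [map_mul, map_mul] at h3
          exact absurd (mul_right_cancel h3) hne
        · exact Or.inr (Or.inl h2)
      · exact Or.inl h1

end IsSemidihedralPair

theorem sq_mul_eq_one_of_mul_inv_eq {A : Type*} [CommGroup A] {v w b m : A}
    (h1 : v * b * w⁻¹ = m⁻¹) (h2 : w * b * v⁻¹ = m⁻¹) : (m * b) ^ 2 = 1 := by
  have h3 : v * b * w⁻¹ * (w * b * v⁻¹) = b * b := by
    rw [mul_comm v b]
    calc b * v * w⁻¹ * (w * b * v⁻¹) = b * (v * b) * v⁻¹ := by group
      _ = b * b := by rw [mul_comm v b]; group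
  rw [h1, h2] at h3
  rw [mul_pow, pow_two b, ← h3]
  group

/-- The automorphism `φ` inverts the abelian normal subgroup `M` of odd order, is trivial on the
quotient by `M` and on the subgroup `P`, and is class-preserving; the element `x` of `P` acts on
`M` in the same way as `φ`. -/
structure IsInvertingAut {G : Type*} [Group G] (φ : MulAut G) (M P : Subgroup G) (x : G) :
    Prop where
  comm : ∀ m n : M, m * n = n * m
  odd_card : Odd (Nat.card M)
  map_eq_inv : ∀ m ∈ M, φ m = m⁻¹
  map_mul_inv_mem : ∀ g, φ g * g⁻¹ ∈ M
  map_eq : ∀ s ∈ P, φ s = s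
  isClassPres : IsClassPres φ
  mem : x ∈ P
  conj_eq : ∀ m ∈ M, x * m * x⁻¹ = m⁻¹

namespace IsInvertingAut

variable {G : Type*} [Group G] {φ : MulAut G} {M P : Subgroup G} {x : G}

theorem eq_one_of_sq_eq_one (h : IsInvertingAut φ M P x) {m : M} (hm : m ^ 2 = 1) : m = 1 := by
  have h1 : m ^ Nat.card M = 1 := pow_card_eq_one'
  have h2 := pow_gcd_eq_one.2 ⟨hm, h1⟩
  rwa [(Nat.coprime_two_left.2 h.odd_card).gcd_eq_one, pow_one] at h2

theorem eq_one_of_inv_eq (h : IsInvertingAut φ M P x) {m : M} (hm : m⁻¹ = m) : m = 1 :=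
  h.eq_one_of_sq_eq_one (by rw [pow_two]; nth_rw 1 [← hm]; exact inv_mul_cancel m)

theorem exists_sq_eq (h : IsInvertingAut φ M P x) (m : M) : ∃ n : M, n ^ 2 = m := by
  obtain ⟨r, hr⟩ := h.odd_card
  refine ⟨m ^ (r + 1), ?_⟩
  have h1 : m ^ Nat.card M = 1 := pow_card_eq_one'
  rw [← pow_mul, show (r + 1) * 2 = Nat.card M + 1 by omega, pow_succ, h1, one_mul]

theorem eq_one_of_map_eq (h : IsInvertingAut φ M P x) {m : G} (hm : m ∈ M) (hφ : φ m = m) :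
    m = 1 :=
  congrArg Subtype.val (h.eq_one_of_inv_eq (m := ⟨m, hm⟩)
    (Subtype.ext ((h.map_eq_inv m hm).symm.trans hφ)))

theorem exists_eq_mul (h : IsInvertingAut φ M P x) (g : G) :
    ∃ m ∈ M, ∃ h : G, φ h = h ∧ g = m * h := by
  obtain ⟨n, hn⟩ := h.exists_sq_eq ⟨φ g * g⁻¹, h.map_mul_inv_mem g⟩
  have hn' : (n : G) * n = φ g * g⁻¹ := by simpa [pow_two] using congrArg Subtype.val hn
  refine ⟨(n : G)⁻¹, inv_mem n.2, n * g, ?_, by group⟩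
  have hφ : φ g = n * n * g := by rw [hn']; group
  rw [map_mul, h.map_eq_inv _ n.2, hφ]
  group

theorem commute_of_mem (h : IsInvertingAut φ M P x) {g k : G} (hg : φ g = g) (hk : φ k = k)
    (hm : g * k * g⁻¹ * k⁻¹ ∈ M) : g * k = k * g := by
  have h1 := h.eq_one_of_map_eq hm (by simp [hg, hk])
  rwa [mul_inv_eq_one, mul_inv_eq_iff_eq_mul] at h1

theorem pow_apply_eq_inv {f : MulAut M} {m : M} (hm : f m = m⁻¹) {n : ℕ} (hn : Odd n) :
    (f ^ n) m = m⁻¹ := by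
  obtain ⟨r, rfl⟩ := hn
  induction r with
  | zero => simpa using hm
  | succ r ih =>
    rw [show 2 * (r + 1) + 1 = (2 * r + 1) + 1 + 1 by ring, pow_succ, pow_succ, MulAut.mul_apply,
      MulAut.mul_apply, hm, map_inv, hm, inv_inv, ih]

theorem map_mul_eq (h : IsInvertingAut φ M P x) {n r : G} (hn : n ∈ M) (hr : φ r = r) :
    φ (n * r) = n⁻¹ * r := by
  rw [map_mul, h.map_eq_inv n hn, hr]

variable [M.Normal]

theorem conjNormal_apply_of_mem (h : IsInvertingAut φ M P x) {m : G} (hm : m ∈ M) (n : M) :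
    MulAut.conjNormal m n = n := by
  ext
  have := congrArg Subtype.val (h.comm ⟨m, hm⟩ n)
  simp only [Subgroup.coe_mul] at this
  rw [MulAut.conjNormal_apply, this, mul_inv_cancel_right]

theorem conjNormal_apply_eq_inv (h : IsInvertingAut φ M P x) (m : M) :
    MulAut.conjNormal x m = m⁻¹ :=
  Subtype.ext (h.conj_eq m m.2)

theorem conjNormal_eq_iff (h : IsInvertingAut φ M P x) {g : G} :
    (MulAut.conjNormal g : MulAut M) = MulAut.conjNormal x ↔
      ∀ m : M, MulAut.conjNormal g m = m⁻¹ := by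
  rw [MulEquiv.ext_iff]
  simp only [h.conjNormal_apply_eq_inv]

theorem conjNormal_central (h : IsInvertingAut φ M P x) (f : MulAut M) :
    MulAut.conjNormal x * f = f * MulAut.conjNormal x := by
  ext m
  simp [h.conjNormal_apply_eq_inv]

theorem conjNormal_sq (h : IsInvertingAut φ M P x) :
    (MulAut.conjNormal x : MulAut M) ^ 2 = 1 := by
  ext m
  simp [pow_two, h.conjNormal_apply_eq_inv]

theorem conjNormal_ne_one (h : IsInvertingAut φ M P x) (hM : M ≠ ⊥) :
    (MulAut.conjNormal x : MulAut M) ≠ 1 := by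
  intro h1
  refine hM ((Subgroup.eq_bot_iff_forall M).2 fun m hm => ?_)
  have h2 : (⟨m, hm⟩ : M)⁻¹ = ⟨m, hm⟩ := by
    rw [← h.conjNormal_apply_eq_inv, h1, MulAut.one_apply]
  exact congrArg Subtype.val (h.eq_one_of_inv_eq h2)

/-- If `f` and `x` act on `M` with `f` an involution, then `f` fixes a nontrivial element, unless
it inverts every element. -/
theorem exists_apply_eq_self (h : IsInvertingAut φ M P x) {f : MulAut M} (hf : f ^ 2 = 1)
    (hne : f ≠ MulAut.conjNormal x) : ∃ m : M, m ≠ 1 ∧ f m = m := by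
  by_contra! hcon
  refine hne (MulEquiv.ext fun m => ?_)
  rw [h.conjNormal_apply_eq_inv]
  have h1 : f (f m) = m := by
    rw [← MulAut.mul_apply, ← pow_two, hf, MulAut.one_apply]
  by_contra h2
  refine hcon (m * f m) (fun h3 => h2 (eq_inv_of_mul_eq_one_right h3)) ?_
  rw [map_mul, h1, h.comm]

theorem exists_commute_apply_eq_inv [Finite G] (h : IsInvertingAut φ M P x) {g : G}
    (hg : φ g = g) (hg2 : (MulAut.conjNormal g : MulAut M) ^ 2 = 1) {m : M}
    (hm : MulAut.conjNormal g m = m) :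
    ∃ c : G, φ c = c ∧ c * g = g * c ∧ MulAut.conjNormal c m = m⁻¹ ∧
      ∃ j : ℕ, c ^ 2 ^ j = 1 := by
  obtain ⟨u, hu⟩ := isConj_iff.1 (h.isClassPres (m * g))
  rw [map_mul, hg, h.map_eq_inv m m.2] at hu
  obtain ⟨v, hv, c, hc, rfl⟩ := h.exists_eq_mul u
  have hcg : c * g = g * c := by
    refine h.commute_of_mem hc hg ?_
    have e : c * g * c⁻¹ * g⁻¹ = (c * m * c⁻¹)⁻¹ * v⁻¹ * (m : G)⁻¹ * (g * v * g⁻¹) := by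
      have : c * m * g * c⁻¹ = v⁻¹ * (m : G)⁻¹ * g * v := by
        have h2 : v⁻¹ * (v * c * (m * g) * (v * c)⁻¹) * v = v⁻¹ * ((m : G)⁻¹ * g) * v := by
          rw [hu]
        simpa [mul_assoc] using h2
      calc c * g * c⁻¹ * g⁻¹ = (c * m * c⁻¹)⁻¹ * (c * m * g * c⁻¹) * g⁻¹ := by group
        _ = _ := by rw [this]; group
    rw [e]
    have hn : M.Normal := inferInstance
    exact mul_mem (mul_mem (mul_mem (inv_mem (hn.conj_mem _ m.2 _)) (inv_mem hv))
      (inv_mem m.2)) (hn.conj_mem _ hv _)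
  have e1 : (⟨v, hv⟩ : M) * MulAut.conjNormal c m * (MulAut.conjNormal g ⟨v, hv⟩)⁻¹ = m⁻¹ := by
    ext
    simp only [Subgroup.coe_mul, MulAut.conjNormal_apply, Subgroup.coe_inv]
    have h3 : v * (c * m * c⁻¹) * (g * v * g⁻¹)⁻¹ = v * c * m * (g * (c⁻¹ * v⁻¹)) * g⁻¹ := by
      have : c⁻¹ * g = g * c⁻¹ := by
        rw [inv_mul_eq_iff_eq_mul, ← mul_assoc, hcg, mul_inv_cancel_right]
      rw [← mul_assoc g, ← this]
      group
    rw [h3]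
    have h4 := congrArg (· * g⁻¹) hu
    simpa [mul_assoc] using h4
  have e2 := congrArg (MulAut.conjNormal g) e1
  have hgg : ∀ n : M, MulAut.conjNormal g (MulAut.conjNormal g n) = n := fun n => by
    rw [← MulAut.mul_apply, ← pow_two, hg2, MulAut.one_apply]
  have hgc : MulAut.conjNormal g (MulAut.conjNormal c m) = MulAut.conjNormal c m := by
    rw [← MulAut.mul_apply, ← map_mul, ← hcg, map_mul, MulAut.mul_apply, hm]
  rw [map_mul, map_mul, map_inv, map_inv, hgg, hgc, hm] at e2
  have e3 : MulAut.conjNormal c m = m⁻¹ := by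
    let _ : CommGroup M := { (inferInstance : Group M) with mul_comm := h.comm }
    have h5 : (m * MulAut.conjNormal c m) ^ 2 = 1 := sq_mul_eq_one_of_mul_inv_eq e1 e2
    exact eq_inv_of_mul_eq_one_right (h.eq_one_of_sq_eq_one h5)
  obtain ⟨n, j, hn, hj⟩ := exists_pow_modEq_one_two_power c 1
  refine ⟨c ^ n, by rw [map_pow, hc], ((show Commute c g from hcg).pow_left n).eq, ?_, j, hj⟩
  rw [map_pow]
  exact pow_apply_eq_inv e3 (Nat.odd_iff.2 hn)

end IsInvertingAut

namespace IsInvertingAut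

variable {G : Type*} [Group G] [Finite G] {φ : MulAut G} {M : Subgroup G} [M.Normal]
  {P : Sylow 2 G} {x : G}

theorem conjNormal_mem_zpowers (h : IsInvertingAut φ M P x) (hP : IsSemidihedral (P : Subgroup G))
    {c : G} {i : ℕ} (hc : (MulAut.conjNormal c : MulAut M) ^ 2 ^ i = 1)
    (hc2 : (MulAut.conjNormal c : MulAut M) ^ 2 ≠ 1) :
    (MulAut.conjNormal x : MulAut M) ∈ Subgroup.zpowers (MulAut.conjNormal c) := by
  obtain ⟨k, a, b, hs⟩ := hP.exists_pair
  let f : (P : Subgroup G) →* MulAut M := MulAut.conjNormal.comp (P : Subgroup G).subtype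
  obtain ⟨g, ⟨s, hsP, e⟩, -⟩ := exists_conj_mem_map_sylow MulAut.conjNormal P c c rfl hc hc
  rw [map_mul, map_mul, map_inv] at e
  have h1 := hs.central_mem_zpowers_of_sq_ne_one f (x := ⟨x, h.mem⟩) (s := ⟨s, hsP⟩)
    (fun s => h.conjNormal_central _) (by
      change (MulAut.conjNormal s : MulAut M) ^ 2 ≠ 1
      rw [← e, conj_pow]
      simpa using hc2)
  change (MulAut.conjNormal x : MulAut M) ∈ Subgroup.zpowers (MulAut.conjNormal s) at h1
  obtain ⟨n, hn⟩ := Subgroup.mem_zpowers_iff.1 h1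
  refine Subgroup.mem_zpowers_iff.2 ⟨n, ?_⟩
  rw [← e, conj_zpow, mul_inv_eq_iff_eq_mul, h.conjNormal_central] at hn
  exact mul_left_cancel hn

theorem conjNormal_eq_of_commute (h : IsInvertingAut φ M P x)
    (hP : IsSemidihedral (P : Subgroup G)) (hM : M ≠ ⊥) {c d : G}
    (hcd : (MulAut.conjNormal c : MulAut M) * MulAut.conjNormal d =
      MulAut.conjNormal d * MulAut.conjNormal c)
    (hc : (MulAut.conjNormal c : MulAut M) ^ 2 = 1) (hd : (MulAut.conjNormal d : MulAut M) ^ 2 = 1)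
    (hc1 : (MulAut.conjNormal c : MulAut M) ≠ 1) (hd1 : (MulAut.conjNormal d : MulAut M) ≠ 1)
    (hne : (MulAut.conjNormal c : MulAut M) ≠ MulAut.conjNormal d) :
    (MulAut.conjNormal x : MulAut M) = MulAut.conjNormal c ∨
      (MulAut.conjNormal x : MulAut M) = MulAut.conjNormal d ∨
      (MulAut.conjNormal x : MulAut M) = MulAut.conjNormal c * MulAut.conjNormal d := by
  obtain ⟨k, a, b, hs⟩ := hP.exists_pair
  let f : (P : Subgroup G) →* MulAut M := MulAut.conjNormal.comp (P : Subgroup G).subtype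
  obtain ⟨g, ⟨s, hsP, es⟩, t, htP, et⟩ := exists_conj_mem_map_sylow MulAut.conjNormal P c d hcd
    (i := 1) (j := 1) (by simpa using hc) (by simpa using hd)
  rw [map_mul, map_mul, map_inv] at es et
  have hfx : (MulAut.conjNormal x : MulAut M) =
      MulAut.conjNormal g * MulAut.conjNormal x * (MulAut.conjNormal g)⁻¹ := by
    rw [eq_mul_inv_iff_mul_eq, h.conjNormal_central]
  have key := hs.central_eq_of_commute f (x := ⟨x, h.mem⟩) (s := ⟨s, hsP⟩) (t := ⟨t, htP⟩)
    (fun s => h.conjNormal_central _) (h.conjNormal_ne_one hM)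
  simp only [f, MonoidHom.comp_apply, Subgroup.subtype_apply, ← es, ← et, conj_pow, hc, hd,
    conj_mul, hcd] at key
  simp only [mul_one, mul_inv_cancel, true_implies, ne_eq, mul_left_inj, mul_right_inj,
    conj_eq_one_iff] at key
  rw [hfx] at key
  simpa [hcd] using key hc1 hd1 hne

/-- Every element fixed by `φ` that centralizes `M` commutes with an element fixed by `φ` that
inverts `M`. -/
theorem exists_commute_conjNormal_eq (h : IsInvertingAut φ M P x)
    (hP : IsSemidihedral (P : Subgroup G)) (hM : M ≠ ⊥) {k : G} (hk : φ k = k)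
    (hk1 : (MulAut.conjNormal k : MulAut M) = 1) :
    ∃ c : G, φ c = c ∧ c * k = k * c ∧ (MulAut.conjNormal c : MulAut M) = MulAut.conjNormal x ∧
      ∃ j : ℕ, c ^ 2 ^ j = 1 := by
  suffices hw : ∃ c : G, φ c = c ∧ Commute c k ∧
      (MulAut.conjNormal c : MulAut M) = MulAut.conjNormal x by
    obtain ⟨c, h1, h2, h3⟩ := hw
    obtain ⟨n, j, hn, hj⟩ := exists_pow_modEq_one_two_power c 1
    refine ⟨c ^ n, by rw [map_pow, h1], (h2.pow_left n).eq, ?_, j, hj⟩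
    obtain ⟨r, rfl⟩ : Odd n := Nat.odd_iff.2 hn
    rw [map_pow, h3, pow_succ, pow_mul, h.conjNormal_sq, one_pow, one_mul]
  by_contra! hno
  have hsq : ∀ c : G, φ c = c → Commute c k → ∀ i : ℕ, c ^ 2 ^ i = 1 →
      (MulAut.conjNormal c : MulAut M) ^ 2 = 1 := by
    intro c h1 h2 i hi
    by_contra hne
    obtain ⟨n, hn⟩ := Subgroup.mem_zpowers_iff.1 (h.conjNormal_mem_zpowers hP
      (i := i) (by rw [← map_pow, hi, map_one]) hne)
    exact hno (c ^ n) (by rw [map_zpow, h1]) (h2.zpow_left n) (by rw [map_zpow, hn])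
  have huniq : ∀ c d : G, φ c = c → Commute c k → φ d = d → Commute d k →
      (MulAut.conjNormal c : MulAut M) * MulAut.conjNormal d =
        MulAut.conjNormal d * MulAut.conjNormal c →
      (MulAut.conjNormal c : MulAut M) ^ 2 = 1 → (MulAut.conjNormal d : MulAut M) ^ 2 = 1 →
      (MulAut.conjNormal c : MulAut M) ≠ 1 → (MulAut.conjNormal d : MulAut M) ≠ 1 →
      (MulAut.conjNormal c : MulAut M) = MulAut.conjNormal d := by
    intro c d hc hck hd hdk hcd hc2 hd2 hc1 hd1
    by_contra hne
    rcases h.conjNormal_eq_of_commute hP hM hcd hc2 hd2 hc1 hd1 hne with e | e | e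
    · exact hno c hc hck e.symm
    · exact hno d hd hdk e.symm
    · exact hno (c * d) (by rw [map_mul, hc, hd]) (hck.mul_left hdk) (by rw [map_mul, e])
  have hfix : ∀ m : M, MulAut.conjNormal k m = m := by simp [hk1]
  have hk2 : (MulAut.conjNormal k : MulAut M) ^ 2 = 1 := by simp [hk1]
  obtain ⟨m, hm⟩ := Subgroup.ne_bot_iff_exists_ne_one.1 hM
  obtain ⟨c, hc, hck, hcm, i, hi⟩ := h.exists_commute_apply_eq_inv hk hk2 (hfix m)
  have hc2 := hsq c hc hck i hi
  obtain ⟨m₁, hm₁, hcm₁⟩ := h.exists_apply_eq_self hc2 (hno c hc hck)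
  obtain ⟨d, hd, hdk, hdm, j, hj⟩ := h.exists_commute_apply_eq_inv hk hk2 (hfix m₁)
  have hd2 := hsq d hd hdk j hj
  have hne1 : ∀ (g : G) (n : M), n ≠ 1 → MulAut.conjNormal g n = n⁻¹ →
      (MulAut.conjNormal g : MulAut M) ≠ 1 := by
    intro g n hn hgn e
    rw [e, MulAut.one_apply] at hgn
    exact hn (h.eq_one_of_inv_eq hgn.symm)
  have hc1 := hne1 c m hm hcm
  have hd1 := hne1 d m₁ hm₁ hdm
  have hcdm : MulAut.conjNormal (c * d) m₁ = m₁⁻¹ := by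
    rw [map_mul, MulAut.mul_apply, hdm, map_inv, hcm₁]
  have hcdk : Commute (c * d) k := Commute.mul_left hck hdk
  obtain ⟨r, hr⟩ : ∃ r, orderOf (MulAut.conjNormal (c * d) : MulAut M) = r := ⟨_, rfl⟩
  have hr0 : 0 < r := hr ▸ (MonoidHom.isOfFinOrder _ (isOfFinOrder_of_finite (c * d))).orderOf_pos
  rcases Nat.even_or_odd r with ⟨q, rfl⟩ | hodd
  · set v : MulAut M := MulAut.conjNormal ((c * d) ^ q) with hv
    have hv2 : v ^ 2 = 1 := by
      rw [hv, map_pow, ← pow_mul, mul_two, ← hr, pow_orderOf_eq_one]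
    have hv1 : v ≠ 1 := by
      rw [hv, map_pow]
      exact pow_ne_one_of_lt_orderOf (by omega) (by omega)
    have hinv : v⁻¹ = v := inv_eq_of_mul_eq_one_left (by rw [← pow_two, hv2])
    have hconj : ∀ t : MulAut M, t * MulAut.conjNormal (c * d) * t⁻¹ =
        (MulAut.conjNormal (c * d))⁻¹ → t * v = v * t := by
      intro t ht
      rw [← mul_inv_eq_iff_eq_mul, hv, map_pow, ← conj_pow, ht, inv_pow, ← map_pow, ← hv, hinv]
    have ic : (MulAut.conjNormal c : MulAut M)⁻¹ = MulAut.conjNormal c :=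
      inv_eq_of_mul_eq_one_left (by rw [← pow_two, hc2])
    have id' : (MulAut.conjNormal d : MulAut M)⁻¹ = MulAut.conjNormal d :=
      inv_eq_of_mul_eq_one_left (by rw [← pow_two, hd2])
    have hφv : φ ((c * d) ^ q) = (c * d) ^ q := by rw [map_pow, map_mul, hc, hd]
    have e1 := huniq c _ hc hck hφv (hcdk.pow_left q) (hconj _ (by
      rw [map_mul, mul_inv_rev, ic, id', ← mul_assoc, ← pow_two, hc2, one_mul])) hc2 hv2 hc1 hv1
    have e2 := huniq d _ hd hdk hφv (hcdk.pow_left q) (hconj _ (by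
      rw [map_mul, mul_inv_rev, ic, id', mul_assoc, mul_assoc, ← pow_two, hd2, mul_one]))
      hd2 hv2 hd1 hv1
    rw [e1, ← e2, hdm] at hcm₁
    exact hm₁ (h.eq_one_of_inv_eq hcm₁)
  · have e := pow_apply_eq_inv hcdm hodd
    rw [← hr, pow_orderOf_eq_one, MulAut.one_apply] at e
    exact hm₁ (h.eq_one_of_inv_eq e.symm)

end IsInvertingAut

namespace IsInvertingAut

variable {G : Type*} [Group G] [Finite G] {φ : MulAut G} {M : Subgroup G} [M.Normal]
  {P : Sylow 2 G} {x : G}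

/-- If the Sylow `2`-subgroup acts faithfully on `M`, then `φ` is inner. -/
theorem isInnerAut_of_faithful (h : IsInvertingAut φ M P x)
    (hP : IsSemidihedral (P : Subgroup G)) (hM : M ≠ ⊥)
    (hf : ∀ s ∈ P, (MulAut.conjNormal s : MulAut M) = 1 → s = 1) : IsInnerAut φ := by
  have hinj : ∀ s ∈ P, ∀ t ∈ P, (MulAut.conjNormal s : MulAut M) = MulAut.conjNormal t →
      s = t := by
    intro s hs t ht e
    rw [← mul_inv_eq_one]
    exact hf _ (mul_mem hs (inv_mem ht)) (by rw [map_mul, map_inv, e, mul_inv_cancel])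
  have hx2 : x ^ 2 = 1 := hf _ (pow_mem h.mem 2) (by rw [map_pow, h.conjNormal_sq])
  have hxinv : x⁻¹ = x := inv_eq_of_mul_eq_one_left (by rw [← pow_two, hx2])
  have hxc : ∀ y : G, x * (x * y) = y := fun y => by rw [← mul_assoc, ← pow_two, hx2, one_mul]
  have hφx : φ x = x := h.map_eq x h.mem
  have hone : ∀ (w : G) (j : ℕ), (MulAut.conjNormal w : MulAut M) = 1 → w ^ 2 ^ j = 1 →
      w = 1 := by
    intro w j hw hj
    obtain ⟨g, hg, -⟩ := exists_conj_mem_sylow P w w rfl hj hj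
    exact conj_eq_one_iff.1 (hf _ hg (by simp [hw]))
  have hodd : ∀ w : G, (MulAut.conjNormal w : MulAut M) = 1 → ∃ r : ℕ, w ^ (2 * r + 1) = 1 := by
    intro w hw
    obtain ⟨n, j, hn, hj⟩ := exists_pow_modEq_one_two_power w 1
    obtain ⟨r, rfl⟩ : Odd n := Nat.odd_iff.2 hn
    exact ⟨r, hone _ j (by rw [map_pow, hw, one_pow]) hj⟩
  have hsq : ∀ (i : G) (j : ℕ), (MulAut.conjNormal i : MulAut M) = MulAut.conjNormal x →
      i ^ 2 ^ j = 1 → i ^ 2 = 1 := by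
    intro i j hi hj
    obtain ⟨g, hg, -⟩ := exists_conj_mem_sylow P i i rfl hj hj
    have := hinj _ hg x h.mem (by
      rw [map_mul, map_mul, map_inv, hi, mul_inv_eq_iff_eq_mul, h.conjNormal_central])
    rwa [← conj_eq_one_iff (a := g), ← conj_pow, this]
  let K : Subgroup G := (MulAut.conjNormal : G →* MulAut M).ker ⊓
    φ.toMonoidHom.eqLocus (MonoidHom.id G)
  have hK : ∀ k, k ∈ K ↔ (MulAut.conjNormal k : MulAut M) = 1 ∧ φ k = k := fun k => Iff.rfl
  have htop : (Subgroup.centralizer {x}).subgroupOf K = ⊤ := by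
    refine eq_top_of_forall_exists_conj_mem _ fun ⟨k, hk⟩ => ?_
    obtain ⟨hk1, hk⟩ := (hK k).1 hk
    obtain ⟨i, hi, hik, hix, j, hj⟩ := h.exists_commute_conjNormal_eq hP hM hk hk1
    have hi2 := hsq i j hix hj
    have hiinv : i⁻¹ = i := inv_eq_of_mul_eq_one_left (by rw [← pow_two, hi2])
    have hw : (MulAut.conjNormal (i * x) : MulAut M) = 1 := by
      rw [map_mul, hix, ← pow_two, h.conjNormal_sq]
    obtain ⟨r, hr⟩ := hodd _ hw
    have hxw : ∀ n : ℕ, x * (i * x) ^ n * x⁻¹ = ((i * x) ^ n)⁻¹ := by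
      intro n
      rw [← conj_pow, ← inv_pow, mul_inv_rev, hiinv, hxinv, mul_assoc, mul_assoc, ← pow_two x, hx2,
        mul_one]
    have hg : (i * x) ^ (r + 1) ∈ K :=
      (hK _).2 ⟨by rw [map_pow, hw, one_pow], by rw [map_pow, map_mul, hi, hφx]⟩
    have hgx : (i * x) ^ (r + 1) * x = i * (i * x) ^ (r + 1) := by
      have e1 : (i * x) ^ (r + 1) * x * ((i * x) ^ (r + 1))⁻¹ =
          (i * x) ^ (r + 1) * (i * x) ^ (r + 1) * x := by
        rw [← hxw, ← mul_assoc, ← mul_assoc, hxinv, mul_assoc _ x x, ← pow_two, hx2, mul_one]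
      rw [← pow_add, show r + 1 + (r + 1) = 2 * r + 1 + 1 by ring, pow_succ _ (2 * r + 1), hr,
        one_mul, mul_assoc i x x, ← pow_two x, hx2, mul_one] at e1
      exact mul_inv_eq_iff_eq_mul.1 e1
    refine ⟨⟨_, hg⟩, ?_⟩
    rw [Subgroup.mem_subgroupOf, Subgroup.mem_centralizer_singleton_iff]
    simp only [Subgroup.coe_mul, Subgroup.coe_inv]
    set g := (i * x) ^ (r + 1)
    have hx' : x = g⁻¹ * i * g := by rw [mul_assoc, ← hgx, inv_mul_cancel_left]
    rw [hx']
    calc g⁻¹ * k * g * (g⁻¹ * i * g) = g⁻¹ * (k * i) * g := by group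
      _ = g⁻¹ * i * g * (g⁻¹ * k * g) := by rw [← hik]; group
  have hcomm : ∀ k ∈ K, k * x = x * k := by
    intro k hk
    have : (⟨k, hk⟩ : K) ∈ (Subgroup.centralizer {x}).subgroupOf K := htop ▸ Subgroup.mem_top _
    rwa [Subgroup.mem_subgroupOf, Subgroup.mem_centralizer_singleton_iff] at this
  have hfix : ∀ g, φ g = g → g * x = x * g := by
    intro g hg
    have hw : (MulAut.conjNormal (g * x * g⁻¹ * x) : MulAut M) = 1 := by
      rw [map_mul, map_mul, map_mul, map_inv, ← h.conjNormal_central (MulAut.conjNormal g), mul_inv_cancel_right,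
        ← pow_two, h.conjNormal_sq]
    have h1 := hcomm _ ((hK (g * x * g⁻¹ * x)).2 ⟨hw, by simp [hg, hφx]⟩)
    have h2 : g * x * g⁻¹ * x = 1 := by
      refine hone _ 1 hw ?_
      have h3 : x * (g * x * g⁻¹) = g * x * g⁻¹ * x := by
        refine mul_right_cancel (b := x) ?_
        rw [h1, mul_assoc]
      rw [pow_one, pow_two]
      nth_rw 2 [← h3]
      simp [mul_assoc, hxc]
    rw [mul_eq_one_iff_eq_inv, hxinv, mul_inv_eq_iff_eq_mul] at h2
    exact h2
  refine ⟨x, MulEquiv.ext fun g => ?_⟩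
  obtain ⟨m, hm, c, hc, rfl⟩ := h.exists_eq_mul g
  rw [map_mul, hc, h.map_eq_inv m hm, MulAut.conj_apply, ← h.conj_eq m hm]
  calc x * m * x⁻¹ * c = x * m * x⁻¹ * (c * x) * x⁻¹ := by group
    _ = x * (m * c) * x⁻¹ := by rw [hfix c hc]; group

end IsInvertingAut

namespace IsInvertingAut

variable {G : Type*} [Group G] [Finite G] {φ : MulAut G} {M : Subgroup G} [M.Normal]
  {P : Sylow 2 G} {x : G}

theorem conjNormal_eq_one_or_eq (h : IsInvertingAut φ M P x) {k : ℕ} {a b : (P : Subgroup G)}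
    (hs : IsSemidihedralPair k a b)
    (hz : (MulAut.conjNormal (a ^ 2 ^ k : (P : Subgroup G)) : MulAut M) = 1) :
    (MulAut.conjNormal (b : G) : MulAut M) = 1 ∨
      (MulAut.conjNormal (b : G) : MulAut M) = MulAut.conjNormal x := by
  by_contra! hne
  obtain ⟨hb1, hbx⟩ := hne
  let f : (P : Subgroup G) →* MulAut M := MulAut.conjNormal.comp (P : Subgroup G).subtype
  have hb2 : (b : G) ^ 2 = 1 := by exact_mod_cast congrArg Subtype.val hs.sq_right
  have hρb2 : (MulAut.conjNormal (b : G) : MulAut M) ^ 2 = 1 := by rw [← map_pow, hb2, map_one]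
  obtain ⟨m, hm, hbm⟩ := h.exists_apply_eq_self hρb2 hbx
  obtain ⟨c, hc, hcb, hcm, j, hj⟩ := h.exists_commute_apply_eq_inv (h.map_eq b b.2) hρb2 hbm
  obtain ⟨g, hgb, hgc⟩ := exists_conj_mem_sylow P (b : G) c hcb.symm (i := 1) (by simpa using hb2) hj
  have key := hs.map_eq_one_or_eq_of_commute f hz (s := ⟨_, hgb⟩) (t := ⟨_, hgc⟩)
    (Subtype.ext (by simp [hcb])) (Subtype.ext (by simp [hb2])) (by simpa [f] using hb1)
  have hcm' : MulAut.conjNormal c m = m := by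
    rcases key with e | e
    · have : (MulAut.conjNormal c : MulAut M) = 1 := by simpa [f] using e
      rw [this, MulAut.one_apply]
    · have : (MulAut.conjNormal c : MulAut M) = MulAut.conjNormal (b : G) := by simpa [f] using e
      rw [this, hbm]
  exact hm (h.eq_one_of_inv_eq (hcm.symm.trans hcm'))

/-- If the Sylow `2`-subgroup does not act faithfully on `M`, then it acts as a group of exponent
two, and leaves a nontrivial cyclic subgroup of `M` invariant. -/
theorem exists_apply_eq_or_eq_inv (h : IsInvertingAut φ M P x) (hM : M ≠ ⊥) {k : ℕ}
    {a b : (P : Subgroup G)} (hs : IsSemidihedralPair k a b)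
    (hz : (MulAut.conjNormal (a ^ 2 ^ k : (P : Subgroup G)) : MulAut M) = 1) :
    (∀ s ∈ P, (MulAut.conjNormal s : MulAut M) ^ 2 = 1) ∧
      ∃ m : M, m ≠ 1 ∧ ∀ s ∈ P, MulAut.conjNormal s m = m ∨ MulAut.conjNormal s m = m⁻¹ := by
  let f : (P : Subgroup G) →* MulAut M := MulAut.conjNormal.comp (P : Subgroup G).subtype
  have hb := h.conjNormal_eq_one_or_eq hs hz
  have hba : ∀ s, f b * s = s * f b := by
    intro s
    rcases hb with e | e
    · change MulAut.conjNormal (b : G) * s = s * MulAut.conjNormal (b : G)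
      rw [e, one_mul, mul_one]
    · change MulAut.conjNormal (b : G) * s = s * MulAut.conjNormal (b : G)
      rw [e, h.conjNormal_central]
  have hb2 : f b ^ 2 = 1 := by rw [← map_pow, hs.sq_right, map_one]
  have ha2 : f a ^ 2 = 1 := hs.map_sq_eq_one_of_commute f hs.right_notMem
    (Subgroup.mem_zpowers a) (hba _)
  have hw2 : ∀ w ∈ Subgroup.zpowers a, f w ^ 2 = 1 := by
    rintro _ ⟨n, rfl⟩
    simp only [map_zpow]
    rw [← zpow_natCast, ← zpow_mul, mul_comm, zpow_mul, zpow_natCast, ha2, one_zpow]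
  refine ⟨fun s hsP => ?_, ?_⟩
  · change f ⟨s, hsP⟩ ^ 2 = 1
    rcases hs.mem_or_mul_mem ⟨s, hsP⟩ with hm | hm
    · exact hw2 _ hm
    · have := hw2 _ hm
      rwa [map_mul, Commute.mul_pow (hba _).symm, hb2, mul_one] at this
  obtain ⟨m, hm, ham⟩ : ∃ m : M, m ≠ 1 ∧ (f a m = m ∨ f a m = m⁻¹) := by
    by_cases hax : f a = MulAut.conjNormal x
    · obtain ⟨m, hm⟩ := Subgroup.ne_bot_iff_exists_ne_one.1 hM
      exact ⟨m, hm, Or.inr (by rw [hax, h.conjNormal_apply_eq_inv])⟩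
    · obtain ⟨m, hm, ham⟩ := h.exists_apply_eq_self ha2 hax
      exact ⟨m, hm, Or.inl ham⟩
  refine ⟨m, hm, ?_⟩
  have hbm : f b m = m ∨ f b m = m⁻¹ := by
    rcases hb with e | e
    · exact Or.inl (by change MulAut.conjNormal (b : G) m = m; rw [e, MulAut.one_apply])
    · exact Or.inr (by
        change MulAut.conjNormal (b : G) m = m⁻¹; rw [e, h.conjNormal_apply_eq_inv])
  let N : Subgroup (P : Subgroup G) :=
    { carrier := {s | f s m = m ∨ f s m = m⁻¹}
      one_mem' := Or.inl (by simp)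
      mul_mem' := by
        rintro s t (hs | hs) (ht | ht) <;> simp [MulAut.mul_apply, hs, ht]
      inv_mem' := by
        rintro s (hs | hs)
        · exact Or.inl (by rw [map_inv, MulAut.inv_apply, MulEquiv.symm_apply_eq, hs])
        · exact Or.inr (by rw [map_inv, MulAut.inv_apply, MulEquiv.symm_apply_eq, map_inv, hs,
            inv_inv]) }
  have haN : Subgroup.zpowers a ≤ N := Subgroup.zpowers_le.2 ham
  have hbN : b ∈ N := hbm
  intro s hsP
  change (⟨s, hsP⟩ : (P : Subgroup G)) ∈ N
  rcases hs.mem_or_mul_mem ⟨s, hsP⟩ with hm | hm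
  · exact haN hm
  · exact (Subgroup.mul_mem_cancel_right N hbN).1 (haN hm)

theorem exists_commute_conjNormal_apply_eq_inv (h : IsInvertingAut φ M P x)
    (hP : IsSemidihedral (P : Subgroup G))
    (hexp : ∀ s ∈ P, (MulAut.conjNormal s : MulAut M) ^ 2 = 1) {r s : G} (hr : φ r = r)
    (hs : s ∈ P) (hrs : (MulAut.conjNormal r : MulAut M) = MulAut.conjNormal s) {m : M}
    (hm : m ≠ 1) (hrm : MulAut.conjNormal r m = m) :
    ∃ c : G, φ c = c ∧ c * r = r * c ∧ MulAut.conjNormal c m = m⁻¹ ∧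
      ∃ t ∈ P, (MulAut.conjNormal c : MulAut M) = MulAut.conjNormal t := by
  have hM : M ≠ ⊥ := Subgroup.ne_bot_iff_exists_ne_one.2 ⟨m, hm⟩
  by_cases hr1 : (MulAut.conjNormal r : MulAut M) = 1
  · obtain ⟨c, hc, hcr, hcx, -⟩ := h.exists_commute_conjNormal_eq hP hM hr hr1
    exact ⟨c, hc, hcr, by rw [hcx, h.conjNormal_apply_eq_inv], x, h.mem, hcx⟩
  have hr2 : (MulAut.conjNormal r : MulAut M) ^ 2 = 1 := by rw [hrs, hexp s hs]
  obtain ⟨c, hc, hcr, hcm, j, hj⟩ := h.exists_commute_apply_eq_inv hr hr2 hrm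
  refine ⟨c, hc, hcr, hcm, ?_⟩
  obtain ⟨g, hg, -⟩ := exists_conj_mem_sylow P c c rfl hj hj
  have hc2 : (MulAut.conjNormal c : MulAut M) ^ 2 = 1 := by
    have := hexp _ hg
    rwa [map_mul, map_mul, map_inv, conj_pow, conj_eq_one_iff] at this
  have hmne : m⁻¹ ≠ m := fun e => hm (h.eq_one_of_inv_eq e)
  have hc1 : (MulAut.conjNormal c : MulAut M) ≠ 1 := by
    intro e
    rw [e, MulAut.one_apply] at hcm
    exact hmne hcm.symm
  have hcrne : (MulAut.conjNormal c : MulAut M) ≠ MulAut.conjNormal r := by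
    intro e
    rw [e, hrm] at hcm
    exact hmne hcm.symm
  rcases h.conjNormal_eq_of_commute hP hM (by rw [← map_mul, hcr, map_mul]) hc2 hr2 hc1 hr1
    hcrne with e | e | e
  · exact ⟨x, h.mem, e.symm⟩
  · have := h.conjNormal_apply_eq_inv m
    rw [e, hrm] at this
    exact absurd this.symm hmne
  · exact ⟨x * s⁻¹, mul_mem h.mem (inv_mem hs), by
      rw [map_mul, map_inv, ← hrs, e, mul_inv_cancel_right]⟩

end IsInvertingAut

theorem IsSemidihedral.of_mulEquiv {S T : Type*} [Group S] [Group T] (e : S ≃* T)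
    (h : IsSemidihedral S) : IsSemidihedral T := by
  obtain ⟨n, hn, hcard, a, b, ha, hb, hab, hc⟩ := h
  refine ⟨n, hn, by rw [← Nat.card_congr e.toEquiv, hcard], e a, e b, ?_, ?_, ?_, ?_⟩
  · rw [← map_pow, ha, map_one]
  · rw [← map_pow, hb, map_one]
  · rw [← map_inv, ← map_mul, ← map_mul, hab, map_pow]
  · have := congrArg (Subgroup.map e.toMonoidHom) hc
    rw [MonoidHom.map_closure, Subgroup.map_top_of_surjective _ e.surjective] at this
    simpa [Set.image_pair] using this

/-- An automorphism restricts to a subgroup that it maps to itself, if it is an involution on that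
subgroup. -/
def restrictInvolutive {G : Type*} [Group G] (φ : MulAut G) (H : Subgroup G)
    (h₁ : ∀ g ∈ H, φ g ∈ H) (h₂ : ∀ g ∈ H, φ (φ g) = g) : MulAut H where
  toFun g := ⟨φ g, h₁ g g.2⟩
  invFun g := ⟨φ g, h₁ g g.2⟩
  left_inv g := Subtype.ext (h₂ g g.2)
  right_inv g := Subtype.ext (h₂ g g.2)
  map_mul' g g' := Subtype.ext (map_mul φ (g : G) g')

namespace IsInvertingAut

variable {G : Type*} [Group G] {φ : MulAut G} {M P : Subgroup G} [M.Normal] {x : G}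

/-- The extension of `Z` by the group of the elements fixed by `φ` that act on `M` in the same way
as an element of `P`. -/
def extension (φ : MulAut G) (M P Z : Subgroup G) [M.Normal] (hZM : Z ≤ M)
    (hZ : ∀ s ∈ P, ∀ n ∈ Z, s * n * s⁻¹ ∈ Z) : Subgroup G :=
  have key : ∀ r s : G, s ∈ P → (MulAut.conjNormal r : MulAut M) = MulAut.conjNormal s →
      ∀ n ∈ Z, r * n * r⁻¹ ∈ Z := by
    intro r s hs e n hn
    have := congrArg Subtype.val (DFunLike.congr_fun e ⟨n, hZM hn⟩)
    rw [MulAut.conjNormal_apply, MulAut.conjNormal_apply] at this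
    rw [this]
    exact hZ s hs n hn
  { carrier := {g | ∃ n ∈ Z, ∃ r, φ r = r ∧
      (∃ s ∈ P, (MulAut.conjNormal r : MulAut M) = MulAut.conjNormal s) ∧ g = n * r}
    one_mem' := ⟨1, one_mem Z, 1, map_one φ, ⟨1, one_mem P, rfl⟩, (mul_one 1).symm⟩
    mul_mem' := by
      rintro _ _ ⟨n, hn, r, hr, ⟨s, hs, e⟩, rfl⟩ ⟨n', hn', r', hr', ⟨s', hs', e'⟩, rfl⟩
      exact ⟨n * (r * n' * r⁻¹), mul_mem hn (key r s hs e n' hn'), r * r',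
        by rw [map_mul, hr, hr'], ⟨s * s', mul_mem hs hs', by rw [map_mul, map_mul, e, e']⟩,
        by group⟩
    inv_mem' := by
      rintro _ ⟨n, hn, r, hr, ⟨s, hs, e⟩, rfl⟩
      have e' : (MulAut.conjNormal r⁻¹ : MulAut M) = MulAut.conjNormal s⁻¹ := by
        rw [map_inv, map_inv, e]
      exact ⟨r⁻¹ * n⁻¹ * r⁻¹⁻¹, key _ _ (inv_mem hs) e' _ (inv_mem hn), r⁻¹,
        by rw [map_inv, hr], ⟨s⁻¹, inv_mem hs, e'⟩, by group⟩ }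

theorem mem_extension {Z : Subgroup G} {hZM : Z ≤ M} {hZ : ∀ s ∈ P, ∀ n ∈ Z, s * n * s⁻¹ ∈ Z}
    {g : G} : g ∈ extension φ M P Z hZM hZ ↔ ∃ n ∈ Z, ∃ r, φ r = r ∧
      (∃ s ∈ P, (MulAut.conjNormal r : MulAut M) = MulAut.conjNormal s) ∧ g = n * r :=
  Iff.rfl

theorem mem_extension_of_map_eq {Z : Subgroup G} {hZM : Z ≤ M}
    {hZ : ∀ s ∈ P, ∀ n ∈ Z, s * n * s⁻¹ ∈ Z} {r s : G} (hr : φ r = r) (hs : s ∈ P)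
    (e : (MulAut.conjNormal r : MulAut M) = MulAut.conjNormal s) :
    r ∈ extension φ M P Z hZM hZ :=
  ⟨1, one_mem Z, r, hr, ⟨s, hs, e⟩, (one_mul r).symm⟩

theorem mem_extension_of_mem {Z : Subgroup G} {hZM : Z ≤ M}
    {hZ : ∀ s ∈ P, ∀ n ∈ Z, s * n * s⁻¹ ∈ Z} {n : G} (hn : n ∈ Z) :
    n ∈ extension φ M P Z hZM hZ :=
  ⟨n, hn, 1, map_one φ, ⟨1, one_mem P, rfl⟩, (mul_one n).symm⟩

theorem le_extension (h : IsInvertingAut φ M P x) {Z : Subgroup G} {hZM : Z ≤ M}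
    {hZ : ∀ s ∈ P, ∀ n ∈ Z, s * n * s⁻¹ ∈ Z} : P ≤ extension φ M P Z hZM hZ :=
  fun s hs => mem_extension_of_map_eq (h.map_eq s hs) hs rfl

theorem le_of_extension_eq_top (h : IsInvertingAut φ M P x) {Z : Subgroup G} {hZM : Z ≤ M}
    {hZ : ∀ s ∈ P, ∀ n ∈ Z, s * n * s⁻¹ ∈ Z} (htop : extension φ M P Z hZM hZ = ⊤) : M ≤ Z := by
  intro y hy
  obtain ⟨n, hn, r, hr, -, rfl⟩ := mem_extension.1 (htop ▸ Subgroup.mem_top y)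
  rwa [h.eq_one_of_map_eq ((Subgroup.mul_mem_cancel_left M (hZM hn)).1 hy) hr, mul_one]

/-- The restriction of `φ` to the extension. -/
def restrict (h : IsInvertingAut φ M P x) {Z : Subgroup G} (hZM : Z ≤ M)
    (hZ : ∀ s ∈ P, ∀ n ∈ Z, s * n * s⁻¹ ∈ Z) : MulAut (extension φ M P Z hZM hZ) :=
  restrictInvolutive φ (extension φ M P Z hZM hZ)
    (by
      rintro _ ⟨n, hn, r, hr, hs, rfl⟩
      exact ⟨n⁻¹, inv_mem hn, r, hr, hs, h.map_mul_eq (hZM hn) hr⟩)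
    (by
      rintro _ ⟨n, hn, r, hr, hs, rfl⟩
      rw [h.map_mul_eq (hZM hn) hr, h.map_mul_eq (inv_mem (hZM hn)) hr, inv_inv])

theorem coe_restrict_apply (h : IsInvertingAut φ M P x) {Z : Subgroup G} (hZM : Z ≤ M)
    (hZ : ∀ s ∈ P, ∀ n ∈ Z, s * n * s⁻¹ ∈ Z) (g : extension φ M P Z hZM hZ) :
    (h.restrict hZM hZ g : G) = φ g :=
  rfl

theorem orderOf_restrict (h : IsInvertingAut φ M P x) {Z : Subgroup G} (hZM : Z ≤ M)
    (hZ : ∀ s ∈ P, ∀ n ∈ Z, s * n * s⁻¹ ∈ Z) : ∃ k : ℕ, orderOf (h.restrict hZM hZ) = 2 ^ k := by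
  obtain ⟨k, -, hk⟩ := (Nat.dvd_prime_pow Nat.prime_two (m := 1)).1
    (orderOf_dvd_of_pow_eq_one (x := h.restrict hZM hZ) (n := 2 ^ 1) (by
      rw [pow_one, pow_two]
      exact MulEquiv.ext fun g => (h.restrict hZM hZ).left_inv g))
  exact ⟨k, hk⟩

/-- The extension has the same Sylow `2`-subgroups as `G`. -/
theorem isSemidihedral_sylow_extension [Finite G] {P : Sylow 2 G} (h : IsInvertingAut φ M P x)
    (hP : IsSemidihedral (P : Subgroup G)) {Z : Subgroup G} {hZM : Z ≤ M}
    {hZ : ∀ s ∈ (P : Subgroup G), ∀ n ∈ Z, s * n * s⁻¹ ∈ Z}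
    (Q : Sylow 2 (extension φ M P Z hZM hZ)) :
    IsSemidihedral (Q : Subgroup (extension φ M P Z hZM hZ)) :=
  hP.of_mulEquiv ((Subgroup.subgroupOfEquivOfLe h.le_extension).symm.trans
    ((P.subtype h.le_extension).equiv Q))

theorem isColemanAut_restrict [Finite G] (h : IsInvertingAut φ M P x) (hφ : IsColemanAut φ) {p : ℕ}
    (hp : p.Prime) (hM : IsPGroup p M) {Z : Subgroup G} (hZM : Z ≤ M)
    (hZ : ∀ s ∈ P, ∀ n ∈ Z, s * n * s⁻¹ ∈ Z) : IsColemanAut (h.restrict hZM hZ) := by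
  intro q hq Q
  have := Fact.mk hp
  have := Fact.mk hq
  let G₁ := extension φ M P Z hZM hZ
  suffices hy : ∃ y ∈ G₁, ∀ u : G₁, u ∈ (Q : Subgroup G₁) → φ u = y⁻¹ * u * y by
    obtain ⟨y, hy, hu⟩ := hy
    exact ⟨⟨y, hy⟩, fun u hu' => Subtype.ext (hu u hu')⟩
  by_cases hqp : q = p
  · subst hqp
    obtain ⟨L, hL⟩ := ((Q.isPGroup'.map G₁.subtype).to_sup_of_normal_right hM).exists_le_sylow
    obtain ⟨y, hy⟩ := hφ q hq L
    obtain ⟨v, hv, r, hr, rfl⟩ := h.exists_eq_mul y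
    have hML : M ≤ L := le_sup_right.trans hL
    have hQL : ∀ u : G₁, u ∈ (Q : Subgroup G₁) → (u : G) ∈ L := fun u hu =>
      hL (Subgroup.mem_sup_left ⟨u, hu, rfl⟩)
    have hrx : (MulAut.conjNormal r : MulAut M) = MulAut.conjNormal x := by
      have e : (MulAut.conjNormal (v * r) : MulAut M) = MulAut.conjNormal x := by
        rw [h.conjNormal_eq_iff]
        intro m
        ext
        have := hy _ (hML (inv_mem m.2))
        rw [h.map_eq_inv _ (inv_mem m.2), inv_inv] at this
        rw [MulAut.conjNormal_apply, this]
        simp only [Subgroup.coe_inv]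
        group
      rw [← e, map_mul, show (MulAut.conjNormal v : MulAut M) = 1 from
        MulEquiv.ext (h.conjNormal_apply_of_mem hv), one_mul]
    refine ⟨r, mem_extension_of_map_eq hr h.mem hrx, ?_⟩
    rintro ⟨_, n, hn, w, hw, hws, rfl⟩ hu
    have hnM := hZM hn
    have hwL : w ∈ L := (Subgroup.mul_mem_cancel_left (L : Subgroup G) (hML hnM)).1 (hQL _ hu)
    have hrw : r * w = w * r := by
      refine h.commute_of_mem hr hw ?_
      have e := hy w hwL
      rw [hw] at e
      have e' : v * r * w = w * (v * r) := by
        nth_rw 1 [e]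
        group
      have e2 : r * w * r⁻¹ * w⁻¹ = v⁻¹ * (w * v * w⁻¹) := by
        calc r * w * r⁻¹ * w⁻¹ = v⁻¹ * (v * r * w) * r⁻¹ * w⁻¹ := by group
          _ = v⁻¹ * (w * v * w⁻¹) := by rw [e']; group
      rw [e2]
      exact mul_mem (inv_mem hv) ((inferInstance : M.Normal).conj_mem v hv w)
    have hrn : r * n⁻¹ * r⁻¹ = n := by
      have := congrArg Subtype.val (DFunLike.congr_fun hrx (⟨n, hnM⟩ : M)⁻¹)
      rwa [h.conjNormal_apply_eq_inv, inv_inv, MulAut.conjNormal_apply] at this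
    rw [h.map_mul_eq hnM hw]
    calc n⁻¹ * w = r⁻¹ * (r * n⁻¹ * r⁻¹) * (r * w) := by group
      _ = r⁻¹ * (n * w) * r := by rw [hrn, hrw]; group
  · have hZp : IsPGroup p Z := hM.to_le hZM
    obtain ⟨i, hi⟩ := IsPGroup.iff_card.1 hZp
    obtain ⟨j, hj⟩ := IsPGroup.iff_card.1 (Q.isPGroup'.map G₁.subtype)
    obtain ⟨n, hn, hnu⟩ := exists_eq_conj_of_coprime Z ((Q : Subgroup G₁).map G₁.subtype)
      (fun y hy z hz => congrArg Subtype.val (h.comm ⟨y, hZM hy⟩ ⟨z, hZM hz⟩))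
      (by
        rintro _ ⟨⟨_, n, hn, r, hr, ⟨s, hs, e⟩, rfl⟩, -, rfl⟩ m hm
        have := congrArg Subtype.val (DFunLike.congr_fun e ⟨m, hZM hm⟩)
        rw [MulAut.conjNormal_apply, MulAut.conjNormal_apply] at this
        have e2 : n * r * m * (n * r)⁻¹ = n * (r * m * r⁻¹) * n⁻¹ := by group
        simp only [Subgroup.subtype_apply]
        rw [e2, this]
        exact mul_mem (mul_mem hn (hZ s hs m hm)) (inv_mem hn))
      φ.toMonoidHom
      (by
        rintro _ ⟨⟨_, n, hn, r, hr, hs, rfl⟩, -, rfl⟩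
        change φ (n * r) * (n * r)⁻¹ ∈ Z
        rw [h.map_mul_eq (hZM hn) hr, mul_inv_rev, mul_assoc, mul_inv_cancel_left]
        exact mul_mem (inv_mem hn) (inv_mem hn))
      (by
        rw [hi, hj]
        exact Nat.Coprime.pow _ _ ((Nat.coprime_primes hq hp).2 hqp))
    refine ⟨n⁻¹, mem_extension_of_mem (inv_mem hn), fun u hu => ?_⟩
    rw [inv_inv]
    exact hnu u ⟨u, hu, rfl⟩

end IsInvertingAut

namespace IsInvertingAut

theorem mul_mul_inv_eq_inv_of_mem_zpowers {G : Type*} [Group G] {g m n : G}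
    (hg : g * m * g⁻¹ = m⁻¹) (hn : n ∈ Subgroup.zpowers m) : g * n * g⁻¹ = n⁻¹ := by
  obtain ⟨i, rfl⟩ := hn
  simp only
  rw [← conj_zpow, hg, inv_zpow]

theorem conj_mem_zpowers {G : Type*} [Group G] {M P : Subgroup G} [M.Normal] {m : M}
    (hact : ∀ s ∈ P, MulAut.conjNormal s m = m ∨ MulAut.conjNormal s m = m⁻¹) :
    ∀ s ∈ P, ∀ n ∈ Subgroup.zpowers (m : G), s * n * s⁻¹ ∈ Subgroup.zpowers (m : G) := by
  rintro s hs _ ⟨i, rfl⟩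
  simp only
  rw [← conj_zpow, ← MulAut.conjNormal_apply]
  refine zpow_mem ?_ i
  rcases hact s hs with e | e
  · rw [e]
    exact Subgroup.mem_zpowers _
  · rw [e]
    exact inv_mem (Subgroup.mem_zpowers _)

theorem isClassPres_restrict {G : Type*} [Group G] [Finite G] {φ : MulAut G} {M : Subgroup G}
    [M.Normal] {P : Sylow 2 G} {x : G} (h : IsInvertingAut φ M P x)
    (hP : IsSemidihedral (P : Subgroup G))
    (hexp : ∀ s ∈ P, (MulAut.conjNormal s : MulAut M) ^ 2 = 1) {m : M} (hm : m ≠ 1)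
    (hact : ∀ s ∈ P, MulAut.conjNormal s m = m ∨ MulAut.conjNormal s m = m⁻¹)
    (hZM : Subgroup.zpowers (m : G) ≤ M) :
    IsClassPres (h.restrict hZM (conj_mem_zpowers hact)) := by
  rintro ⟨_, n, hn, r, hr, ⟨s, hs, e⟩, rfl⟩
  have hinv : ∀ c : G, MulAut.conjNormal c m = m⁻¹ → c * n * c⁻¹ = n⁻¹ := fun c hc =>
    mul_mul_inv_eq_inv_of_mem_zpowers (by rw [← MulAut.conjNormal_apply, hc]; rfl) hn
  rw [isConj_iff]
  rcases hact s hs with hsm | hsm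
  · obtain ⟨c, hc, hcr, hcm, t, ht, hct⟩ :=
      h.exists_commute_conjNormal_apply_eq_inv hP hexp hr hs e hm (by rw [e, hsm])
    refine ⟨⟨c, mem_extension_of_map_eq hc ht hct⟩, Subtype.ext ?_⟩
    rw [coe_restrict_apply]
    change c * (n * r) * c⁻¹ = φ (n * r)
    rw [h.map_mul_eq (hZM hn) hr, ← hinv c hcm]
    calc c * (n * r) * c⁻¹ = c * n * c⁻¹ * (c * r) * c⁻¹ := by group
      _ = c * n * c⁻¹ * r := by rw [hcr]; group
  · refine ⟨⟨n⁻¹, mem_extension_of_mem (inv_mem hn)⟩, Subtype.ext ?_⟩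
    rw [coe_restrict_apply]
    change n⁻¹ * (n * r) * n⁻¹⁻¹ = φ (n * r)
    have e2 := hinv r (by rw [e, hsm])
    rw [mul_inv_eq_iff_eq_mul] at e2
    rw [h.map_mul_eq (hZM hn) hr, inv_inv, mul_assoc, mul_assoc, e2, inv_mul_cancel_left]

theorem not_isInnerAut_restrict {G : Type*} [Group G] [Finite G] {φ : MulAut G} {M : Subgroup G}
    [M.Normal] {P : Sylow 2 G} {x : G} (h : IsInvertingAut φ M P x) {m : M} (hm : m ≠ 1)
    (hcen : ∀ s ∈ P, (∀ t ∈ P, s * t = t * s) → (MulAut.conjNormal s : MulAut M) = 1)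
    (hZM : Subgroup.zpowers (m : G) ≤ M)
    (hZ : ∀ s ∈ P, ∀ n ∈ Subgroup.zpowers (m : G), s * n * s⁻¹ ∈ Subgroup.zpowers (m : G)) :
    ¬ IsInnerAut (h.restrict hZM hZ) := by
  rintro ⟨⟨g, hgE⟩, hg⟩
  obtain ⟨n, hn, r, hr, -, rfl⟩ := mem_extension.1 hgE
  have hconj : ∀ u ∈ extension φ M P _ hZM hZ, φ u = n * r * u * (n * r)⁻¹ := fun u hu => by
    have e := DFunLike.congr_fun hg ⟨u, hu⟩
    exact congrArg Subtype.val e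
  have hrs : ∀ s ∈ P, Commute r s := by
    intro s hs
    have hφs := h.map_eq s hs
    refine h.commute_of_mem hr hφs ?_
    have e := hconj s (h.le_extension hs)
    rw [hφs, eq_mul_inv_iff_mul_eq] at e
    have e2 : r * s * r⁻¹ * s⁻¹ = n⁻¹ * (s * n * s⁻¹) := by
      calc r * s * r⁻¹ * s⁻¹ = n⁻¹ * (n * r * s) * r⁻¹ * s⁻¹ := by group
        _ = n⁻¹ * (s * n * s⁻¹) := by rw [← e]; group
    rw [e2]
    exact mul_mem (inv_mem (hZM hn)) ((inferInstance : M.Normal).conj_mem n (hZM hn) s)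
  have hrm : MulAut.conjNormal r m = m⁻¹ := by
    have e : MulAut.conjNormal (n * r) m = m⁻¹ := by
      ext
      rw [MulAut.conjNormal_apply,
        ← hconj m (mem_extension_of_mem (Subgroup.mem_zpowers (m : G))), h.map_eq_inv m m.2]
      rfl
    rwa [map_mul, MulAut.mul_apply, h.conjNormal_apply_of_mem (hZM hn)] at e
  obtain ⟨i, j, hi, hj⟩ := exists_pow_modEq_one_two_power r 1
  have hmem : r ^ i ∈ P := by
    have h2 : IsPGroup 2 (Subgroup.zpowers (r ^ i)) := by
      rw [IsPGroup.iff_card]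
      obtain ⟨l, -, hl⟩ := (Nat.dvd_prime_pow Nat.prime_two).1 (orderOf_dvd_of_pow_eq_one hj)
      exact ⟨l, by rw [Nat.card_zpowers, hl]⟩
    have hle : Subgroup.zpowers (r ^ i) ≤ Subgroup.normalizer ((P : Subgroup G) : Set G) := by
      rw [Subgroup.zpowers_le]
      refine Subgroup.centralizer_le_normalizer _ (Subgroup.mem_centralizer_iff.2 fun s hs => ?_)
      exact ((hrs s hs).pow_left i).eq.symm
    rw [← SetLike.mem_coe, ← Sylow.coe_coe,
      ← P.is_maximal' (h2.to_sup_of_normal_right' P.isPGroup' hle) le_sup_right]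
    exact Subgroup.mem_sup_left (Subgroup.mem_zpowers _)
  have e1 := hcen _ hmem fun t ht => ((hrs t ht).pow_left i).eq
  have e2 := pow_apply_eq_inv hrm (Nat.odd_iff.2 hi)
  rw [← map_pow, e1, MulAut.one_apply] at e2
  exact hm (h.eq_one_of_inv_eq e2.symm)

/-- If every automorphism of a proper subgroup with the same Sylow `2`-subgroups as `G` that shares
the properties of `φ` is inner, then `φ` is inner or `M` is cyclic. -/
theorem isInnerAut_or_exists_eq_zpowers {G : Type u} [Group G] [Finite G] {φ : MulAut G}
    {M : Subgroup G} [M.Normal] {P : Sylow 2 G} {x : G} (h : IsInvertingAut φ M P x)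
    (hP : IsSemidihedral (P : Subgroup G)) (hM : M ≠ ⊥) (hφ : IsColemanAut φ) {p : ℕ}
    (hp : p.Prime) (hMp : IsPGroup p M)
    (hmin : ∀ (H : Type u) [Group H] [Finite H], Nat.card H < Nat.card G →
      (∀ S : Sylow 2 H, IsSemidihedral (S : Subgroup H)) →
      ∀ ψ : MulAut H, (∃ k : ℕ, orderOf ψ = 2 ^ k) → IsClassPres ψ → IsColemanAut ψ →
        IsInnerAut ψ) :
    IsInnerAut φ ∨ ∃ m : G, M = Subgroup.zpowers m := by
  obtain ⟨k, a, b, hs⟩ := hP.exists_pair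
  by_cases hz : (MulAut.conjNormal (a ^ 2 ^ k : (P : Subgroup G)) : MulAut M) = 1
  · right
    obtain ⟨hexp, m, hm, hact⟩ := h.exists_apply_eq_or_eq_inv hM hs hz
    have hZM : Subgroup.zpowers (m : G) ≤ M := Subgroup.zpowers_le.2 m.2
    refine ⟨m, le_antisymm (h.le_of_extension_eq_top (hZM := hZM) (hZ := conj_mem_zpowers hact) ?_)
      hZM⟩
    by_contra hne
    refine h.not_isInnerAut_restrict hm ?_ hZM (conj_mem_zpowers hact) (hmin _
      (lt_of_le_of_ne (Subgroup.card_le_card_group _) fun e => hne (Subgroup.eq_top_of_card_eq _ e))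
      (h.isSemidihedral_sylow_extension hP) _ (h.orderOf_restrict hZM _)
      (h.isClassPres_restrict hP hexp hm hact hZM) (h.isColemanAut_restrict hφ hp hMp hZM _))
    intro s hsP hcen
    by_cases hs1 : s = 1
    · rw [hs1, map_one]
    · have e := hs.eq_center_of_central (x := ⟨s, hsP⟩)
        (fun t => Subtype.ext (hcen t t.2)) (fun e => hs1 (congrArg Subtype.val e))
      rwa [← e] at hz
  · left
    refine h.isInnerAut_of_faithful hP hM fun s hsP e => ?_
    by_contra hs1
    exact hz (hs.map_center_eq_one_of_map_eq_one
      (MulAut.conjNormal.comp (P : Subgroup G).subtype) (s := ⟨s, hsP⟩)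
      (fun e => hs1 (congrArg Subtype.val e)) e)

end IsInvertingAut

theorem isSemidihedral_sylow_quotient {G : Type*} [Group G] [Finite G] {M : Subgroup G} [M.Normal]
    (hM : Odd (Nat.card M)) (hG : ∀ S : Sylow 2 G, IsSemidihedral (S : Subgroup G))
    (Q : Sylow 2 (G ⧸ M)) : IsSemidihedral (Q : Subgroup (G ⧸ M)) := by
  obtain ⟨S, rfl⟩ := Sylow.mapSurjective_surjective (QuotientGroup.mk'_surjective M) 2 Q
  have hinj : Function.Injective ((QuotientGroup.mk' M).comp (S : Subgroup G).subtype) := by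
    rw [injective_iff_map_eq_one]
    rintro ⟨s, hs⟩ e
    have hsM : s ∈ M := (QuotientGroup.eq_one_iff s).1 e
    obtain ⟨j, hj⟩ := S.isPGroup' ⟨s, hs⟩
    have h1 : s ^ 2 ^ j = 1 := congrArg Subtype.val hj
    have h2 : s ^ Nat.card M = 1 :=
      congrArg Subtype.val (pow_card_eq_one' (G := M) (x := ⟨s, hsM⟩))
    have h3 := pow_gcd_eq_one.2 ⟨h1, h2⟩
    rw [((Nat.coprime_two_left.2 hM).pow_left j).gcd_eq_one, pow_one] at h3
    exact Subtype.ext h3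
  rw [Sylow.coe_mapSurjective]
  refine (hG S).of_mulEquiv ((MonoidHom.ofInjective hinj).trans (MulEquiv.subgroupCongr ?_))
  rw [MonoidHom.range_comp, Subgroup.range_subtype]

section Quotient

variable {G : Type*} [Group G] [Finite G] {φ : MulAut G} {M : Subgroup G} [M.Normal]

theorem IsClassPres.map_eq (h : IsClassPres φ) : M.map (φ : G →* G) = M := by
  refine Subgroup.eq_of_le_of_card_ge ?_
    (Subgroup.card_map_of_injective (f := (φ : G →* G)) φ.injective).ge
  rintro _ ⟨m, hm, rfl⟩
  obtain ⟨c, hc⟩ := isConj_iff.1 (h m)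
  change φ m ∈ M
  rw [← hc]
  exact (inferInstance : M.Normal).conj_mem m hm c

theorem IsClassPres.congr (h : IsClassPres φ) :
    IsClassPres (QuotientGroup.congr M M φ h.map_eq : MulAut (G ⧸ M)) := by
  intro g
  obtain ⟨g, rfl⟩ := QuotientGroup.mk_surjective g
  exact (QuotientGroup.mk' M).map_isConj (h g)

theorem IsColemanAut.congr (hφ : IsColemanAut φ) (h : IsClassPres φ) :
    IsColemanAut (QuotientGroup.congr M M φ h.map_eq : MulAut (G ⧸ M)) := by
  intro q hq Q
  have := Fact.mk hq
  obtain ⟨S, rfl⟩ := Sylow.mapSurjective_surjective (QuotientGroup.mk'_surjective M) q Q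
  obtain ⟨y, hy⟩ := hφ q hq S
  refine ⟨QuotientGroup.mk' M y, ?_⟩
  rintro _ ⟨s, hs, rfl⟩
  change QuotientGroup.mk' M (φ s) = _
  rw [hy s hs]
  simp only [map_mul, map_inv]

theorem IsClassPres.congr_pow (h : IsClassPres φ) {n : ℕ} (hn : φ ^ n = 1) :
    (QuotientGroup.congr M M φ h.map_eq : MulAut (G ⧸ M)) ^ n = 1 := by
  have key : ∀ (i : ℕ) (g : G), ((QuotientGroup.congr M M φ h.map_eq : MulAut (G ⧸ M)) ^ i)
      (g : G ⧸ M) = ((φ ^ i) g : G) := by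
    intro i
    induction i with
    | zero => intro g; rfl
    | succ i ih =>
      intro g
      rw [pow_succ, pow_succ, MulAut.mul_apply, MulAut.mul_apply, ← ih]
      rfl
  refine MulEquiv.ext fun g => ?_
  obtain ⟨g, rfl⟩ := QuotientGroup.mk_surjective g
  rw [key, hn]
  rfl

end Quotient

section Conj

variable {G : Type*} [Group G] {φ : MulAut G}

theorem IsClassPres.conj_mul (h : IsClassPres φ) (y : G) : IsClassPres (MulAut.conj y * φ) :=
  fun g => (h g).trans (isConj_iff.2 ⟨y, rfl⟩)

theorem IsColemanAut.conj_mul (h : IsColemanAut φ) (y : G) :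
    IsColemanAut (MulAut.conj y * φ) := by
  intro q hq Q
  obtain ⟨c, hc⟩ := h q hq Q
  refine ⟨c * y⁻¹, fun u hu => ?_⟩
  rw [MulAut.mul_apply, MulAut.conj_apply, hc u hu]
  group

theorem IsInnerAut.of_conj_mul {y : G} (h : IsInnerAut (MulAut.conj y * φ)) : IsInnerAut φ := by
  obtain ⟨g, hg⟩ := h
  exact ⟨y⁻¹ * g, by rw [map_mul, map_inv, ← hg, inv_mul_cancel_left]⟩

theorem exists_conj_mul_pow_eq (φ : MulAut G) (y : G) (n : ℕ) :
    ∃ z : G, (MulAut.conj y * φ) ^ n = MulAut.conj z * φ ^ n := by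
  induction n with
  | zero => exact ⟨1, by simp⟩
  | succ n ih =>
    obtain ⟨z, hz⟩ := ih
    refine ⟨z * (φ ^ n) y, ?_⟩
    rw [pow_succ, hz, pow_succ]
    ext g
    simp [MulAut.mul_apply, mul_assoc]

/-- An automorphism of `2`-power order can be changed by an inner automorphism into a power of a
given automorphism in the same class that has `2`-power order. -/
theorem exists_conj_mul_pow_eq_self [Finite G] {k : ℕ} (hφ : φ ^ 2 ^ k = 1) (y : G) :
    ∃ (n j : ℕ) (z : G), (MulAut.conj y * φ) ^ n = MulAut.conj z * φ ∧
      (MulAut.conj z * φ) ^ 2 ^ j = 1 := by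
  obtain ⟨n, j, hn, hj⟩ := exists_pow_modEq_one_two_power (MulAut.conj y * φ) k
  obtain ⟨z, hz⟩ := exists_conj_mul_pow_eq φ y n
  have e : φ ^ n = φ := by
    nth_rw 2 [← pow_one φ]
    exact pow_eq_pow_iff_modEq.2 (hn.of_dvd (orderOf_dvd_of_pow_eq_one hφ))
  rw [e] at hz
  exact ⟨n, j, z, hz, by rw [← hz, hj]⟩

end Conj

/-- If `φ` induces an inner automorphism of the quotient by the abelian normal subgroup `M` of odd
order, then some automorphism in the class of `φ` is trivial on this quotient and on a given Sylow
`2`-subgroup. -/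
theorem exists_conj_mul_normalized {G : Type*} [Group G] [Finite G] {φ : MulAut G} {M : Subgroup G}
    [M.Normal] (hcomm : ∀ m n : M, m * n = n * m) (hodd : Odd (Nat.card M)) (P : Sylow 2 G) {k : ℕ}
    (hk : φ ^ 2 ^ k = 1) (h : IsClassPres φ)
    (hin : IsInnerAut (QuotientGroup.congr M M φ h.map_eq : MulAut (G ⧸ M))) :
    ∃ (z : G) (j : ℕ), (MulAut.conj z * φ) ^ 2 ^ j = 1 ∧
      (∀ g, (MulAut.conj z * φ) g * g⁻¹ ∈ M) ∧ ∀ s ∈ P, (MulAut.conj z * φ) s = s := by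
  have hn : M.Normal := inferInstance
  obtain ⟨g₀, hg₀⟩ := hin
  obtain ⟨y, rfl⟩ := QuotientGroup.mk_surjective g₀
  have h1 : ∀ g, (MulAut.conj y⁻¹ * φ) g * g⁻¹ ∈ M := by
    intro g
    have e : ((φ g : G) : G ⧸ M) = y * g * (y : G ⧸ M)⁻¹ :=
      DFunLike.congr_fun hg₀ (g : G ⧸ M)
    rw [← QuotientGroup.eq_one_iff, MulAut.mul_apply, MulAut.conj_apply]
    simp only [QuotientGroup.mk_mul, QuotientGroup.mk_inv, e]
    group
  obtain ⟨i, hi⟩ := IsPGroup.iff_card.1 P.isPGroup'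
  obtain ⟨m, hm, hmP⟩ := exists_eq_conj_of_coprime M P
    (fun x hx y hy => congrArg Subtype.val (hcomm ⟨x, hx⟩ ⟨y, hy⟩))
    (fun u _ m hm => hn.conj_mem m hm u) (MulAut.conj y⁻¹ * φ).toMonoidHom (fun u _ => h1 u)
    (by rw [hi]; exact (Nat.coprime_two_left.2 hodd).pow_left i)
  have hmP' : ∀ s ∈ P, (MulAut.conj y⁻¹ * φ) s = m * s * m⁻¹ := hmP
  obtain ⟨n, j, z, hz, hj⟩ := exists_conj_mul_pow_eq_self hk (m⁻¹ * y⁻¹)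
  refine ⟨z, j, hj, ?_, ?_⟩
  · rw [← hz]
    have h2 : ∀ g, (MulAut.conj (m⁻¹ * y⁻¹) * φ) g * g⁻¹ ∈ M := by
      intro g
      have e : (MulAut.conj (m⁻¹ * y⁻¹) * φ) g * g⁻¹ =
          m⁻¹ * ((MulAut.conj y⁻¹ * φ) g * g⁻¹) * (g * m * g⁻¹) := by
        simp [MulAut.mul_apply, mul_assoc]
      rw [e]
      exact mul_mem (mul_mem (inv_mem hm) (h1 g)) (hn.conj_mem m hm g)
    clear hz
    induction n with
    | zero => simp
    | succ n ih =>
      intro g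
      rw [pow_succ, MulAut.mul_apply]
      have := mul_mem (ih ((MulAut.conj (m⁻¹ * y⁻¹) * φ) g)) (h2 g)
      rwa [mul_assoc, inv_mul_cancel_left] at this
  · intro s hs
    rw [← hz]
    have h2 : (MulAut.conj (m⁻¹ * y⁻¹) * φ) s = s := by
      rw [map_mul, mul_assoc, MulAut.mul_apply, hmP' s hs, MulAut.conj_apply]
      group
    clear hz
    induction n with
    | zero => rfl
    | succ n ih => rw [pow_succ, MulAut.mul_apply, h2, ih]

theorem mul_comm_of_minimal {G : Type*} [Group G] [Finite G] {M : Subgroup G} [M.Normal] {p : ℕ}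
    (hp : p.Prime) (hM : IsPGroup p M) (hMnt : M ≠ ⊥)
    (hmin : ∀ N : Subgroup G, N.Normal → N ≤ M → N ≠ ⊥ → N = M) (m n : M) : m * n = n * m := by
  have := Fact.mk hp
  have : Nontrivial M := (Subgroup.nontrivial_iff_ne_bot M).2 hMnt
  have hZ := hM.center_nontrivial
  have h1 : (Subgroup.center M).map M.subtype = M := by
    refine hmin _ ConjAct.normal_of_characteristic_of_normal (Subgroup.map_subtype_le _) ?_
    rw [Ne, Subgroup.map_eq_bot_iff_of_injective _ M.subtype_injective]
    exact (Subgroup.nontrivial_iff_ne_bot _).1 hZ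
  obtain ⟨z, hz, e⟩ : (n : G) ∈ (Subgroup.center M).map M.subtype := h1.ge n.2
  rw [← Subtype.ext e]
  exact Subgroup.mem_center_iff.1 hz m

/-- An automorphism with trivial action on `G ⧸ M` and on `M` is trivial if its order is prime to
the order of `M`. -/
theorem eq_one_of_forall_map_eq {G : Type*} [Group G] {ψ : MulAut G} {M : Subgroup G}
    (hodd : Odd (Nat.card M)) {j : ℕ} (hj : ψ ^ 2 ^ j = 1) (hψ : ∀ g, ψ g * g⁻¹ ∈ M)
    (hfix : ∀ m ∈ M, ψ m = m) : ψ = 1 := by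
  have h1 : ψ ^ Nat.card M = 1 := by
    refine MulEquiv.ext fun g => ?_
    have key : ∀ n : ℕ, (ψ ^ n) g = (ψ g * g⁻¹) ^ n * g := by
      intro n
      induction n with
      | zero => simp
      | succ n ih =>
        rw [pow_succ', MulAut.mul_apply, ih, map_mul, map_pow, hfix _ (hψ g), pow_succ, mul_assoc,
          inv_mul_cancel_right]
    have h2 : (ψ g * g⁻¹) ^ Nat.card M = 1 :=
      congrArg Subtype.val (pow_card_eq_one' (G := M) (x := ⟨_, hψ g⟩))
    rw [key, h2, one_mul, MulAut.one_apply]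
  have h3 := pow_gcd_eq_one.2 ⟨hj, h1⟩
  rwa [((Nat.coprime_two_left.2 hodd).pow_left j).gcd_eq_one, pow_one] at h3

theorem exists_isInvertingAut {G : Type*} [Group G] [Finite G] {ψ : MulAut G} {M : Subgroup G}
    [M.Normal] {p : ℕ} (hp : p.Prime) (hMp : IsPGroup p M)
    (hcomm : ∀ m n : M, m * n = n * m) (hodd : Odd (Nat.card M))
    (hmin : ∀ N : Subgroup G, N.Normal → N ≤ M → N ≠ ⊥ → N = M) {P : Sylow 2 G}
    (hP : IsSemidihedral (P : Subgroup G)) {j : ℕ} (hj : ψ ^ 2 ^ j = 1) (hne : ψ ≠ 1)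
    (hcl : IsClassPres ψ) (hcol : IsColemanAut ψ) (hψ : ∀ g, ψ g * g⁻¹ ∈ M)
    (hψP : ∀ s ∈ P, ψ s = s) : ∃ x, IsInvertingAut ψ M P x := by
  have := Fact.mk hp
  have hn : M.Normal := inferInstance
  have hcomm' : ∀ m ∈ M, ∀ n ∈ M, m * n = n * m := fun m hm n hn =>
    congrArg Subtype.val (hcomm ⟨m, hm⟩ ⟨n, hn⟩)
  have hψconj : ∀ g, ∀ m ∈ M, ψ m ∈ M → ψ (g * m * g⁻¹) = g * ψ m * g⁻¹ := by
    intro g m hm hψm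
    have e : ψ (g * m * g⁻¹) =
        (ψ g * g⁻¹) * (g * ψ m * g⁻¹) * (ψ g * g⁻¹)⁻¹ := by
      rw [map_mul, map_mul, map_inv]; group
    rw [e, hcomm' _ (hψ g) _ (hn.conj_mem _ hψm g), mul_inv_cancel_right]
  have hfix : ∀ m ∈ M, ψ m = m → m = 1 := by
    let C : Subgroup G := M ⊓ ψ.toMonoidHom.eqLocus (MonoidHom.id G)
    have hC : ∀ m, m ∈ C ↔ m ∈ M ∧ ψ m = m := fun m => Iff.rfl
    have hCn : C.Normal := by
      refine ⟨fun m hm g => ?_⟩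
      obtain ⟨hm, hψm⟩ := (hC m).1 hm
      exact (hC _).2 ⟨hn.conj_mem m hm g, by rw [hψconj g m hm (hψm.symm ▸ hm), hψm]⟩
    have hCb : C = ⊥ := by
      by_contra hCb
      refine hne (eq_one_of_forall_map_eq hodd hj hψ fun m hm => ?_)
      rw [← hmin C hCn inf_le_left hCb] at hm
      exact ((hC m).1 hm).2
    intro m hm hψm
    exact (Subgroup.mem_bot).1 (hCb ▸ (hC m).2 ⟨hm, hψm⟩)
  obtain ⟨L, hL⟩ := hMp.exists_le_sylow
  obtain ⟨y, hy⟩ := hcol p hp L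
  have ht : ∀ m : M, (MulAut.conjNormal y⁻¹ m : G) = ψ m := by
    intro m
    rw [MulAut.conjNormal_apply, inv_inv, hy m (hL m.2)]
  have hψM : ∀ m ∈ M, ψ m ∈ M := fun m hm => by
    rw [← ht ⟨m, hm⟩]
    exact (MulAut.conjNormal y⁻¹ (⟨m, hm⟩ : M)).2
  have htpow : ∀ (n : ℕ) (m : M), (((MulAut.conjNormal y⁻¹ : MulAut M) ^ n) m : G) =
      (ψ ^ n) m := by
    intro n
    induction n with
    | zero => intro m; rfl
    | succ n ih => intro m; rw [pow_succ, pow_succ, MulAut.mul_apply, MulAut.mul_apply, ih, ht]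
  have htj : (MulAut.conjNormal y⁻¹ : MulAut M) ^ 2 ^ j = 1 :=
    MulEquiv.ext fun m => Subtype.ext (by rw [htpow, hj]; rfl)
  have htcen : ∀ g : G, (MulAut.conjNormal g : MulAut M) * MulAut.conjNormal y⁻¹ =
      MulAut.conjNormal y⁻¹ * MulAut.conjNormal g := by
    intro g
    refine MulEquiv.ext fun m => Subtype.ext ?_
    rw [MulAut.mul_apply, MulAut.mul_apply, ht (MulAut.conjNormal g m), MulAut.conjNormal_apply g,
      MulAut.conjNormal_apply g, ht, hψconj g m m.2 (hψM m m.2)]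
  obtain ⟨n, i, hni, hi⟩ := exists_pow_modEq_one_two_power y⁻¹ j
  obtain ⟨g, hg, -⟩ := exists_conj_mem_sylow P _ _ rfl hi hi
  have hx : (MulAut.conjNormal (g * y⁻¹ ^ n * g⁻¹) : MulAut M) = MulAut.conjNormal y⁻¹ := by
    have e : (MulAut.conjNormal y⁻¹ : MulAut M) ^ n = MulAut.conjNormal y⁻¹ := by
      nth_rw 2 [← pow_one (MulAut.conjNormal y⁻¹ : MulAut M)]
      exact pow_eq_pow_iff_modEq.2 (hni.of_dvd (orderOf_dvd_of_pow_eq_one htj))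
    rw [map_mul, map_mul, map_inv, map_pow, e, htcen, mul_inv_cancel_right]
  obtain ⟨k, a, b, hs⟩ := hP.exists_pair
  have hx2 := hs.map_sq_eq_one_of_central
    (MulAut.conjNormal.comp (P : Subgroup G).subtype : (P : Subgroup G) →* MulAut M)
    (x := ⟨_, hg⟩) (fun s => by
      change MulAut.conjNormal (g * y⁻¹ ^ n * g⁻¹) * MulAut.conjNormal (s : G) =
        MulAut.conjNormal (s : G) * MulAut.conjNormal (g * y⁻¹ ^ n * g⁻¹)
      rw [hx, htcen])
  change (MulAut.conjNormal (g * y⁻¹ ^ n * g⁻¹) : MulAut M) ^ 2 = 1 at hx2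
  rw [hx] at hx2
  have hinv : ∀ m ∈ M, ψ m = m⁻¹ := by
    intro m hm
    have h2 : ψ (ψ m) = m := by
      have := htpow 2 ⟨m, hm⟩
      rw [hx2, pow_two, MulAut.mul_apply] at this
      exact this.symm
    refine eq_inv_of_mul_eq_one_right (hfix (m * ψ m) (mul_mem hm (hψM m hm)) ?_)
    rw [map_mul, h2, hcomm' _ (hψM m hm) _ hm]
  refine ⟨_, hcomm, hodd, hinv, hψ, hψP, hcl, hg, fun m hm => ?_⟩
  rw [← hinv m hm, ← ht ⟨m, hm⟩, ← hx, MulAut.conjNormal_apply]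

theorem card_eq_of_eq_zpowers {G : Type*} [Group G] [Finite G] {M : Subgroup G} [M.Normal] {p : ℕ}
    (hp : p.Prime) (hMp : IsPGroup p M) (hMnt : M ≠ ⊥)
    (hmin : ∀ N : Subgroup G, N.Normal → N ≤ M → N ≠ ⊥ → N = M) {m : G}
    (hm : M = Subgroup.zpowers m) : Nat.card M = p := by
  have := Fact.mk hp
  have hn : M.Normal := inferInstance
  have hmM : m ∈ M := hm ▸ Subgroup.mem_zpowers m
  have hcard : Nat.card M = orderOf m := by rw [hm, Nat.card_zpowers]
  have hp1 : p ∣ orderOf m := by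
    rw [← hcard]
    exact hMp.card_eq_or_dvd.resolve_left fun e => hMnt (Subgroup.card_eq_one.1 e)
  have hN : (Subgroup.zpowers (m ^ p)).Normal := by
    refine ⟨?_⟩
    rintro _ ⟨i, rfl⟩ g
    obtain ⟨l, hl⟩ : g * m * g⁻¹ ∈ Subgroup.zpowers m := hm ▸ hn.conj_mem m hmM g
    simp only at hl
    refine ⟨l * i, ?_⟩
    simp only
    rw [← conj_zpow, ← conj_pow, ← hl]
    simp only [← zpow_natCast, ← zpow_mul]
    congr 1
    ring
  have hmp : m ^ p = 1 := by
    by_contra hne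
    have h1 := hmin _ hN (Subgroup.zpowers_le.2 (pow_mem hmM p))
      (fun e => hne (Subgroup.zpowers_eq_bot.1 e))
    have h2 := congrArg (fun H : Subgroup G => Nat.card H) h1
    simp only [Nat.card_zpowers, hcard] at h2
    rw [orderOf_pow, Nat.gcd_eq_right hp1] at h2
    exact (Nat.div_lt_self (orderOf_pos m) hp.one_lt).ne h2
  rw [hcard]
  exact Nat.dvd_antisymm (orderOf_dvd_of_pow_eq_one hmp) hp1

/-- In a minimal counterexample, every minimal normal subgroup that is a `p`-group for an
odd prime `p` is cyclic of order `p`. -/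
theorem stmt_19 (G : Type u) [Group G] [Finite G] (φ : MulAut G)
    (hmin : IsMinimalCounterexample G φ)
    (p : ℕ) (hp : p.Prime) (hodd : Odd p)
    (M : Subgroup G) (hMn : M.Normal) (hMnt : M ≠ ⊥)
    (hMmin : ∀ N : Subgroup G, N.Normal → N ≤ M → N ≠ ⊥ → N = M)
    (hMp : IsPGroup p M) :
    IsCyclic M ∧ Nat.card M = p := by
  have := Fact.mk hp
  obtain ⟨hsd, hinn, ⟨k, hk⟩, hcl, hcol, hind⟩ := hmin
  have hk' : φ ^ 2 ^ k = 1 := by rw [← hk, pow_orderOf_eq_one]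
  have hcard : Odd (Nat.card M) := by
    obtain ⟨i, hi⟩ := IsPGroup.iff_card.1 hMp
    rw [hi]
    exact hodd.pow
  have hcomm := mul_comm_of_minimal hp hMp hMnt hMmin
  have hlt : Nat.card (G ⧸ M) < Nat.card G := by
    rw [Subgroup.card_eq_card_quotient_mul_card_subgroup M]
    exact lt_mul_of_one_lt_right Nat.card_pos (Subgroup.one_lt_card_iff_ne_bot M |>.2 hMnt)
  obtain ⟨l, -, hl⟩ := (Nat.dvd_prime_pow Nat.prime_two).1
    (orderOf_dvd_of_pow_eq_one (hcl.congr_pow (M := M) hk'))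
  have hquot := hind (G ⧸ M) hlt (isSemidihedral_sylow_quotient hcard hsd) _ ⟨l, hl⟩ hcl.congr
    (hcol.congr hcl)
  have P : Sylow 2 G := default
  obtain ⟨z, j, hj, hψ, hψP⟩ := exists_conj_mul_normalized hcomm hcard P hk' hcl hquot
  have hψinn : ¬ IsInnerAut (MulAut.conj z * φ) := fun e => hinn e.of_conj_mul
  obtain ⟨x, hx⟩ := exists_isInvertingAut hp hMp hcomm hcard hMmin (hsd P) hj
    (fun e => hψinn ⟨1, by rw [e, map_one]⟩) (hcl.conj_mul z) (hcol.conj_mul z) hψ hψP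
  obtain ⟨m, hm⟩ := (hx.isInnerAut_or_exists_eq_zpowers (hsd P) hMnt (hcol.conj_mul z) hp hMp
    hind).resolve_left hψinn
  refine ⟨?_, card_eq_of_eq_zpowers hp hMp hMnt hMmin hm⟩
  rw [hm]
  infer_instance
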